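/- Let Λ be a finite-dimensional algebra over a field K. The following are equivalent: (1) Λ is brick-finite; (2) every torsion-free class in mod Λ is widely generated; (3) every torsion class in mod Λ is widely generated; (4) every torsion class in mod Λ is finitely generated, i.e., of the form T(M) for a single module M in mod Λ. -/

import Mathlib

open Function DirectSum

namespace BrickPaper

variable (Λ : Type) [Ring Λ]

/-- `M` belongs to `mod Λ`, i.e. is a finitely generated module. -/
abbrev FG (M : ModuleCat.{0} Λ) : Prop := Module.Finite Λ M

/-- A class of modules closed under isomorphism. -/
def IsoClosed (C : Set (ModuleCat.{0} Λ)) : Prop :=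
  ∀ ⦃M N : ModuleCat.{0} Λ⦄, Nonempty (M ≃ₗ[Λ] N) → M ∈ C → N ∈ C

/-- A class of modules containing the zero modules. -/
def HasZeroObj (C : Set (ModuleCat.{0} Λ)) : Prop :=
  ∀ M : ModuleCat.{0} Λ, Subsingleton M → M ∈ C

/-- Closure under extensions: if `0 → A → M → B → 0` is exact with `A, B ∈ C` then `M ∈ C`. -/
def ExtClosed (C : Set (ModuleCat.{0} Λ)) : Prop :=
  ∀ ⦃A M B : ModuleCat.{0} Λ⦄ (f : A →ₗ[Λ] M) (g : M →ₗ[Λ] B),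
    Function.Injective f → Function.Surjective g →
    LinearMap.range f = LinearMap.ker g → A ∈ C → B ∈ C → M ∈ C

/-- Closure under quotients (images of surjections). -/
def QuotClosed (C : Set (ModuleCat.{0} Λ)) : Prop :=
  ∀ ⦃M N : ModuleCat.{0} Λ⦄ (g : M →ₗ[Λ] N), Function.Surjective g → M ∈ C → N ∈ C

/-- Closure under submodules (sources of injections). -/
def SubClosed (C : Set (ModuleCat.{0} Λ)) : Prop :=
  ∀ ⦃M N : ModuleCat.{0} Λ⦄ (f : M →ₗ[Λ] N), Function.Injective f → N ∈ C → M ∈ C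

/-- Closure under kernels of morphisms between members. -/
def KerClosed (C : Set (ModuleCat.{0} Λ)) : Prop :=
  ∀ ⦃M N : ModuleCat.{0} Λ⦄ (f : M →ₗ[Λ] N), M ∈ C → N ∈ C →
    ModuleCat.of Λ ↥(LinearMap.ker f) ∈ C

/-- Closure under cokernels of morphisms between members. -/
def CokerClosed (C : Set (ModuleCat.{0} Λ)) : Prop :=
  ∀ ⦃M N : ModuleCat.{0} Λ⦄ (f : M →ₗ[Λ] N), M ∈ C → N ∈ C →
    ModuleCat.of Λ ((N : Type) ⧸ LinearMap.range f) ∈ C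

/-- A wide subcategory of `mod Λ`: a class of finitely generated modules, closed under
isomorphisms, containing `0`, and closed under kernels, cokernels and extensions. -/
def IsWide (C : Set (ModuleCat.{0} Λ)) : Prop :=
  (∀ M ∈ C, FG Λ M) ∧ IsoClosed Λ C ∧ HasZeroObj Λ C ∧
    KerClosed Λ C ∧ CokerClosed Λ C ∧ ExtClosed Λ C

/-- A wide subcategory of the big module category `Mod Λ` (no finiteness condition). -/
def IsWideBig (C : Set (ModuleCat.{0} Λ)) : Prop :=
  IsoClosed Λ C ∧ HasZeroObj Λ C ∧ KerClosed Λ C ∧ CokerClosed Λ C ∧ ExtClosed Λ C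

/-- A torsion class in `mod Λ`: closed under quotients and extensions. -/
def IsTorsionClass (C : Set (ModuleCat.{0} Λ)) : Prop :=
  (∀ M ∈ C, FG Λ M) ∧ IsoClosed Λ C ∧ HasZeroObj Λ C ∧ QuotClosed Λ C ∧ ExtClosed Λ C

/-- A torsion-free class in `mod Λ`: closed under submodules and extensions. -/
def IsTorsionFreeClass (C : Set (ModuleCat.{0} Λ)) : Prop :=
  (∀ M ∈ C, FG Λ M) ∧ IsoClosed Λ C ∧ HasZeroObj Λ C ∧ SubClosed Λ C ∧ ExtClosed Λ C

/-- The smallest torsion class containing `X`. -/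
def torsClosure (X : Set (ModuleCat.{0} Λ)) : Set (ModuleCat.{0} Λ) :=
  ⋂₀ {C | IsTorsionClass Λ C ∧ X ⊆ C}

/-- The smallest torsion-free class containing `X`. -/
def torfClosure (X : Set (ModuleCat.{0} Λ)) : Set (ModuleCat.{0} Λ) :=
  ⋂₀ {C | IsTorsionFreeClass Λ C ∧ X ⊆ C}

/-- A widely generated torsion class. -/
def IsWidelyGenTors (T : Set (ModuleCat.{0} Λ)) : Prop :=
  IsTorsionClass Λ T ∧ ∃ W, IsWide Λ W ∧ T = torsClosure Λ W

/-- A widely generated torsion-free class. -/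
def IsWidelyGenTorf (F : Set (ModuleCat.{0} Λ)) : Prop :=
  IsTorsionFreeClass Λ F ∧ ∃ W, IsWide Λ W ∧ F = torfClosure Λ W

/-- A finitely generated torsion class: generated by a single module of `mod Λ`. -/
def IsFinGenTors (T : Set (ModuleCat.{0} Λ)) : Prop :=
  IsTorsionClass Λ T ∧ ∃ M : ModuleCat.{0} Λ, FG Λ M ∧ T = torsClosure Λ {M}

/-- `T' ` covers `T` in the poset of torsion classes. -/
def TorsCovers (T' T : Set (ModuleCat.{0} Λ)) : Prop :=
  IsTorsionClass Λ T' ∧ T ⊂ T' ∧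
    ∀ T'', IsTorsionClass Λ T'' → T ⊂ T'' → T'' ⊆ T' → T'' = T'

/-- `F'` covers `F` in the poset of torsion-free classes. -/
def TorfCovers (F' F : Set (ModuleCat.{0} Λ)) : Prop :=
  IsTorsionFreeClass Λ F' ∧ F ⊂ F' ∧
    ∀ F'', IsTorsionFreeClass Λ F'' → F ⊂ F'' → F'' ⊆ F' → F'' = F'

/-- A brick: a finitely generated module whose endomorphism ring is a division ring. -/
def IsBrick (M : ModuleCat.{0} Λ) : Prop :=
  FG Λ M ∧ Nontrivial M ∧ ∀ f : M →ₗ[Λ] M, f ≠ 0 → Function.Bijective f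

/-- A semibrick, regarded as an isomorphism-closed class of bricks (i.e. a set of
isomorphism classes of bricks) which are pairwise Hom-orthogonal. -/
def IsSemibrick (S : Set (ModuleCat.{0} Λ)) : Prop :=
  (∀ M ∈ S, IsBrick Λ M) ∧ IsoClosed Λ S ∧
    ∀ M ∈ S, ∀ N ∈ S, IsEmpty (M ≃ₗ[Λ] N) → ∀ f : M →ₗ[Λ] N, f = 0

/-- A monobrick, regarded as an isomorphism-closed class of bricks (i.e. a set of
isomorphism classes of bricks) such that every morphism between members is zero or injective. -/
def IsMonobrick (S : Set (ModuleCat.{0} Λ)) : Prop :=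
  (∀ M ∈ S, IsBrick Λ M) ∧ IsoClosed Λ S ∧
    ∀ M ∈ S, ∀ N ∈ S, ∀ f : M →ₗ[Λ] N, f = 0 ∨ Function.Injective f

/-- `N` is a cofinal extension of the monobrick `M`. -/
def IsCofinalExtension (M N : Set (ModuleCat.{0} Λ)) : Prop :=
  IsMonobrick Λ N ∧ M ⊆ N ∧
    ∀ X ∈ N, ∃ Y ∈ M, ∃ f : X →ₗ[Λ] Y, Function.Injective f

/-- A cofinally closed monobrick: a monobrick with no proper cofinal extension. -/
def IsCofinallyClosed (M : Set (ModuleCat.{0} Λ)) : Prop :=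
  IsMonobrick Λ M ∧ ∀ N, IsCofinalExtension Λ M N → N = M

/-- `S` contains only finitely many modules up to isomorphism. -/
def FiniteUpToIso (S : Set (ModuleCat.{0} Λ)) : Prop :=
  ∃ B : Set (ModuleCat.{0} Λ), B.Finite ∧ ∀ M ∈ S, ∃ N ∈ B, Nonempty (M ≃ₗ[Λ] N)

/-- `Λ` is brick-finite: there are only finitely many bricks up to isomorphism. -/
def BrickFinite : Prop := FiniteUpToIso Λ {M | IsBrick Λ M}

/-- Right Hom-perpendicular class `T^⊥` inside `mod Λ`. -/
def rPerp (T : Set (ModuleCat.{0} Λ)) : Set (ModuleCat.{0} Λ) :=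
  {M | FG Λ M ∧ ∀ X ∈ T, ∀ f : X →ₗ[Λ] M, f = 0}

/-- Left Hom-perpendicular class `^⊥F` inside `mod Λ`. -/
def lPerp (F : Set (ModuleCat.{0} Λ)) : Set (ModuleCat.{0} Λ) :=
  {M | FG Λ M ∧ ∀ Y ∈ F, ∀ f : M →ₗ[Λ] Y, f = 0}

/-- A minimal extending module for a torsion class `T`. -/
def IsMinExt (T : Set (ModuleCat.{0} Λ)) (M : ModuleCat.{0} Λ) : Prop :=
  FG Λ M ∧ Nontrivial M ∧
    (∀ S : Submodule Λ M, S ≠ ⊥ → ModuleCat.of Λ ((M : Type) ⧸ S) ∈ T) ∧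
    (∀ (X T' : ModuleCat.{0} Λ) (f : M →ₗ[Λ] X) (g : X →ₗ[Λ] T'),
      Function.Injective f → Function.Surjective g →
      LinearMap.range f = LinearMap.ker g → T' ∈ T →
      (¬ ∃ r : X →ₗ[Λ] M, r ∘ₗ f = LinearMap.id) → X ∈ T) ∧
    (∀ X ∈ T, ∀ f : X →ₗ[Λ] M, f = 0)

/-- A minimal co-extending module for a torsion-free class `F`. -/
def IsMinCoext (F : Set (ModuleCat.{0} Λ)) (M : ModuleCat.{0} Λ) : Prop :=
  FG Λ M ∧ Nontrivial M ∧
    (∀ S : Submodule Λ M, S ≠ ⊤ → ModuleCat.of Λ ↥S ∈ F) ∧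
    (∀ (X F' : ModuleCat.{0} Λ) (f : F' →ₗ[Λ] X) (g : X →ₗ[Λ] M),
      Function.Injective f → Function.Surjective g →
      LinearMap.range f = LinearMap.ker g → F' ∈ F →
      (¬ ∃ s : M →ₗ[Λ] X, g ∘ₗ s = LinearMap.id) → X ∈ F) ∧
    (∀ Y ∈ F, ∀ f : M →ₗ[Λ] Y, f = 0)

/-- The set (of representatives of isomorphism classes) of minimal extending modules. -/
def ME (T : Set (ModuleCat.{0} Λ)) : Set (ModuleCat.{0} Λ) := {M | IsMinExt Λ T M}

/-- The set (of representatives of isomorphism classes) of minimal co-extending modules. -/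
def MCE (F : Set (ModuleCat.{0} Λ)) : Set (ModuleCat.{0} Λ) := {M | IsMinCoext Λ F M}

/-- `M` admits a finite filtration with subquotients isomorphic to members of `B`. -/
def FiltMem (B : Set (ModuleCat.{0} Λ)) (M : ModuleCat.{0} Λ) : Prop :=
  ∃ (n : ℕ) (c : Fin (n + 1) → Submodule Λ M), Monotone c ∧ c 0 = ⊥ ∧ c (Fin.last n) = ⊤ ∧
    ∀ i : Fin n, ∃ N ∈ B,
      Nonempty ((↥(c i.succ) ⧸ Submodule.comap (c i.succ).subtype (c i.castSucc)) ≃ₗ[Λ] N)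

/-- `Filt B`. -/
def filtClosure (B : Set (ModuleCat.{0} Λ)) : Set (ModuleCat.{0} Λ) :=
  {M | FiltMem Λ B M}

/-- The simple objects of a subcategory `C`, i.e. nonzero members with no proper nonzero
subobject belonging to `C`. -/
def simOf (C : Set (ModuleCat.{0} Λ)) : Set (ModuleCat.{0} Λ) :=
  {M | M ∈ C ∧ Nontrivial M ∧
    ∀ (X : ModuleCat.{0} Λ) (f : X →ₗ[Λ] M), X ∈ C → Function.Injective f →
      LinearMap.range f = ⊥ ∨ LinearMap.range f = ⊤}

/-- The subcategory `α(T) = {X ∈ T : for all g : Y → X with Y ∈ T, ker g ∈ T}`. -/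
def alphaOf (T : Set (ModuleCat.{0} Λ)) : Set (ModuleCat.{0} Λ) :=
  {X | X ∈ T ∧ ∀ (Y : ModuleCat.{0} Λ) (g : Y →ₗ[Λ] X), Y ∈ T →
    ModuleCat.of Λ ↥(LinearMap.ker g) ∈ T}

/-- Covariantly finite subcategory of `mod Λ`. -/
def CovariantlyFinite (B : Set (ModuleCat.{0} Λ)) : Prop :=
  ∀ M : ModuleCat.{0} Λ, FG Λ M → ∃ N ∈ B, ∃ f : M →ₗ[Λ] N,
    ∀ N' ∈ B, ∀ g : M →ₗ[Λ] N', ∃ h : N →ₗ[Λ] N', h ∘ₗ f = g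

/-- Contravariantly finite subcategory of `mod Λ`. -/
def ContravariantlyFinite (B : Set (ModuleCat.{0} Λ)) : Prop :=
  ∀ M : ModuleCat.{0} Λ, FG Λ M → ∃ N ∈ B, ∃ f : N →ₗ[Λ] M,
    ∀ N' ∈ B, ∀ g : N' →ₗ[Λ] M, ∃ h : N' →ₗ[Λ] N, f ∘ₗ h = g

/-- Functorially finite subcategory of `mod Λ`. -/
def FunctoriallyFinite (B : Set (ModuleCat.{0} Λ)) : Prop :=
  CovariantlyFinite Λ B ∧ ContravariantlyFinite Λ B

/-- Closure under (set-indexed) coproducts. -/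
def CoprodClosed (C : Set (ModuleCat.{0} Λ)) : Prop :=
  ∀ (ι : Type) (M : ι → ModuleCat.{0} Λ), (∀ i, M i ∈ C) →
    ModuleCat.of Λ (⨁ i, (M i : Type)) ∈ C

/-- Closure under (set-indexed) products. -/
def ProdClosed (C : Set (ModuleCat.{0} Λ)) : Prop :=
  ∀ (ι : Type) (M : ι → ModuleCat.{0} Λ), (∀ i, M i ∈ C) →
    ModuleCat.of Λ ((i : ι) → (M i : Type)) ∈ C

/-! Lattice-theoretic notions in the complete lattice of torsion classes. -/

/-- The join of a set of torsion classes. -/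
def torsJoin (X : Set (Set (ModuleCat.{0} Λ))) : Set (ModuleCat.{0} Λ) :=
  torsClosure Λ (⋃₀ X)

/-- The meet of a set of torsion classes (inside the lattice of torsion classes,
whose top element is `mod Λ`). -/
def torsMeet (X : Set (Set (ModuleCat.{0} Λ))) : Set (ModuleCat.{0} Λ) :=
  {M | FG Λ M} ∩ ⋂₀ X

/-- A completely join-irreducible torsion class. -/
def CompletelyJoinIrred (J : Set (ModuleCat.{0} Λ)) : Prop :=
  IsTorsionClass Λ J ∧
    ∀ X : Set (Set (ModuleCat.{0} Λ)), (∀ a ∈ X, IsTorsionClass Λ a) →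
      torsJoin Λ X = J → J ∈ X

/-- `J_* = ⋁ {x : x < J}`. -/
def jstar (J : Set (ModuleCat.{0} Λ)) : Set (ModuleCat.{0} Λ) :=
  torsJoin Λ {C | IsTorsionClass Λ C ∧ C ⊂ J}

/-- `k = κ(J) = max {x : J ∧ x = J_*}`. -/
def IsKappa (J k : Set (ModuleCat.{0} Λ)) : Prop :=
  IsTorsionClass Λ k ∧ J ∩ k = jstar Λ J ∧
    ∀ C, IsTorsionClass Λ C → J ∩ C = jstar Λ J → C ⊆ k

/-- `A` is a join representation of the torsion class `T`. -/
def IsJoinRep (T : Set (ModuleCat.{0} Λ)) (A : Set (Set (ModuleCat.{0} Λ))) : Prop :=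
  (∀ a ∈ A, IsTorsionClass Λ a) ∧ torsJoin Λ A = T

/-- `A` refines `B`. -/
def Refines (A B : Set (Set (ModuleCat.{0} Λ))) : Prop :=
  ∀ a ∈ A, ∃ b ∈ B, a ⊆ b

/-- `A` is the canonical join representation of `T`. -/
def IsCJR (T : Set (ModuleCat.{0} Λ)) (A : Set (Set (ModuleCat.{0} Λ))) : Prop :=
  IsJoinRep Λ T A ∧ (∀ B, IsJoinRep Λ T B → Refines Λ A B) ∧
    ∀ a ∈ A, ∀ b ∈ A, a ⊆ b → a = b

/-- `Kb = κ̄(T) = ⋀ {κ(j) : j ∈ CJR(T)}`, the extended kappa map. -/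
def IsKappaBar (T Kb : Set (ModuleCat.{0} Λ)) : Prop :=
  ∃ A, IsCJR Λ T A ∧ (∀ j ∈ A, CompletelyJoinIrred Λ j) ∧
    (∀ j ∈ A, ∃ k, IsKappa Λ j k) ∧
    Kb = torsMeet Λ {k | ∃ j ∈ A, IsKappa Λ j k}

/-- The kappa order: `a ≤_κ b` iff `a ≤ b` and `κ̄(a) ≥ κ̄(b)`. -/
def KappaLE (a b : Set (ModuleCat.{0} Λ)) : Prop :=
  a ⊆ b ∧ ∀ Ka Kb, IsKappaBar Λ a Ka → IsKappaBar Λ b Kb → Kb ⊆ Ka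

section TorsionTheory

variable {Λ : Type} [Ring Λ] {T : Set (ModuleCat.{0} Λ)}
variable {A B C M N X Y : Type} [AddCommGroup A] [Module Λ A] [AddCommGroup B] [Module Λ B]
  [AddCommGroup C] [Module Λ C] [AddCommGroup M] [Module Λ M] [AddCommGroup N] [Module Λ N]
  [AddCommGroup X] [Module Λ X] [AddCommGroup Y] [Module Λ Y]

/-- Membership of an unbundled module in a class of modules. -/
abbrev In (T : Set (ModuleCat.{0} Λ)) (M : Type) [AddCommGroup M] [Module Λ M] : Prop :=
  ModuleCat.of Λ M ∈ T

namespace IsTorsionClass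

theorem finite (hT : IsTorsionClass Λ T) (h : In T M) : Module.Finite Λ M := hT.1 _ h

theorem equiv (hT : IsTorsionClass Λ T) (e : M ≃ₗ[Λ] N) (h : In T M) : In T N :=
  hT.2.1 (M := ModuleCat.of Λ M) (N := ModuleCat.of Λ N) ⟨e⟩ h

theorem zero (hT : IsTorsionClass Λ T) [h : Subsingleton M] : In T M :=
  hT.2.2.1 (ModuleCat.of Λ M) h

theorem quot (hT : IsTorsionClass Λ T) (g : M →ₗ[Λ] N) (hg : Surjective g) (h : In T M) :
    In T N :=
  hT.2.2.2.1 (M := ModuleCat.of Λ M) (N := ModuleCat.of Λ N) g hg h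

theorem range (hT : IsTorsionClass Λ T) (g : M →ₗ[Λ] N) (h : In T M) : In T (LinearMap.range g) :=
  hT.quot g.rangeRestrict g.surjective_rangeRestrict h

theorem ext (hT : IsTorsionClass Λ T) (f : A →ₗ[Λ] M) (g : M →ₗ[Λ] B) (hf : Injective f)
    (hg : Surjective g) (hfg : LinearMap.range f = LinearMap.ker g) (hA : In T A) (hB : In T B) :
    In T M :=
  hT.2.2.2.2 (A := ModuleCat.of Λ A) (M := ModuleCat.of Λ M) (B := ModuleCat.of Λ B)
    f g hf hg hfg hA hB

theorem of_submodule (hT : IsTorsionClass Λ T) (S : Submodule Λ M) (hS : In T S)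
    (hq : In T (M ⧸ S)) : In T M :=
  hT.ext S.subtype S.mkQ (Submodule.injective_subtype _) S.mkQ_surjective (by simp) hS hq

theorem prod (hT : IsTorsionClass Λ T) (hA : In T A) (hB : In T B) : In T (A × B) :=
  hT.ext (LinearMap.inl Λ A B) (LinearMap.snd Λ A B) LinearMap.inl_injective
    LinearMap.snd_surjective (LinearMap.range_inl Λ A B) hA hB

theorem pi (hT : IsTorsionClass Λ T) (hM : In T M) (n : ℕ) : In T (Fin n → M) := by
  induction n with
  | zero => exact hT.zero
  | succ n ih => exact hT.equiv (Fin.consLinearEquiv Λ (fun _ => M)) (hT.prod hM ih)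

/-- Every finitely generated module has a largest torsion submodule, with torsion-free quotient. -/
theorem exists_torsion_submodule [IsNoetherianRing Λ] (hT : IsTorsionClass Λ T)
    (M : Type) [AddCommGroup M] [Module Λ M] [Module.Finite Λ M] :
    ∃ S : Submodule Λ M, In T S ∧
      ∀ (X : Type) [AddCommGroup X] [Module Λ X], In T X → ∀ f : X →ₗ[Λ] M ⧸ S, f = 0 := by
  have hwf : WellFounded ((· > ·) : Submodule Λ M → Submodule Λ M → Prop) :=
    wellFounded_gt
  obtain ⟨S, hS, hmax⟩ := hwf.has_min {S : Submodule Λ M | In T S} ⟨⊥, hT.zero⟩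
  refine ⟨S, hS, fun X _ _ hX f => ?_⟩
  by_contra hf
  let S' : Submodule Λ M := (LinearMap.range f).comap S.mkQ
  have hle : S ≤ S' := fun x hx => by
    have : S.mkQ x = 0 := by simpa using hx
    simp [S', Submodule.mem_comap, this]
  have hS' : In T S' := by
    let g : S' →ₗ[Λ] LinearMap.range f := S.mkQ.restrict (fun x hx => hx)
    refine hT.ext (Submodule.inclusion hle) g (Submodule.inclusion_injective hle) ?_ ?_ hS
      (hT.range f hX)
    · rintro ⟨y, hy⟩
      obtain ⟨x, rfl⟩ := S.mkQ_surjective y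
      exact ⟨⟨x, hy⟩, rfl⟩
    · rw [Submodule.range_inclusion]
      ext ⟨x, hx⟩
      simp [g, LinearMap.restrict_apply]
  refine hmax S' hS' (lt_of_le_of_ne hle fun h => hf ?_)
  ext x
  obtain ⟨y, hy⟩ := S.mkQ_surjective (f x)
  have : y ∈ S' := by simp only [S', Submodule.mem_comap, hy]; exact ⟨x, rfl⟩
  rw [← h] at this
  rw [← hy]; simpa using this

/-- A finitely generated module covered by images of torsion modules is torsion. -/
theorem of_forall_mem [IsNoetherianRing Λ] (hT : IsTorsionClass Λ T) [Module.Finite Λ M]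
    (h : ∀ m : M, ∃ (X : Type) (_ : AddCommGroup X) (_ : Module Λ X), In T X ∧
      ∃ f : X →ₗ[Λ] M, m ∈ LinearMap.range f) : In T M := by
  obtain ⟨S, hS, h0⟩ := hT.exists_torsion_submodule M
  have : S = ⊤ := by
    rw [eq_top_iff]
    intro m _
    obtain ⟨X, _, _, hX, f, x, rfl⟩ := h m
    have := LinearMap.congr_fun (h0 X hX (S.mkQ ∘ₗ f)) x
    simpa using this
  subst this
  exact hT.equiv Submodule.topEquiv hS

end IsTorsionClass

theorem isTorsionClass_lPerp (F : Set (ModuleCat.{0} Λ)) : IsTorsionClass Λ (lPerp Λ F) := by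
  refine ⟨fun M h => h.1, ?_, ?_, ?_, ?_⟩
  · rintro M N ⟨e⟩ ⟨hM, h⟩
    have := hM
    refine ⟨Module.Finite.equiv e, fun Y hY f => ?_⟩
    have := h Y hY (f ∘ₗ e.toLinearMap)
    ext x
    simpa using LinearMap.congr_fun this (e.symm x)
  · intro M hM
    refine ⟨inferInstance, fun Y hY f => ?_⟩
    ext x
    rw [Subsingleton.elim x 0]; simp
  · rintro M N g hg ⟨hM, h⟩
    have := hM
    refine ⟨Module.Finite.of_surjective g hg, fun Y hY f => ?_⟩
    ext x
    obtain ⟨x, rfl⟩ := hg x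
    exact LinearMap.congr_fun (h Y hY (f ∘ₗ g)) x
  · rintro A M B f g hf hg hfg ⟨hA, hA'⟩ ⟨hB, hB'⟩
    have := hA
    have := hB
    refine ⟨Module.Finite.of_exact (f := f) (g := g) (LinearMap.exact_iff.2 hfg.symm) hg, fun Y hY k => ?_⟩
    have h1 := hA' Y hY (k ∘ₗ f)
    have h2 : LinearMap.ker g ≤ LinearMap.ker k := by
      rw [← hfg]; rintro _ ⟨a, rfl⟩; exact LinearMap.congr_fun h1 a
    have h3 := hB' Y hY (((LinearMap.ker g).liftQ k h2) ∘ₗ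
      (g.quotKerEquivOfSurjective hg).symm.toLinearMap)
    ext x
    have := LinearMap.congr_fun h3 (g x)
    have e : (g.quotKerEquivOfSurjective hg).symm (g x) = (LinearMap.ker g).mkQ x := by
      rw [LinearEquiv.symm_apply_eq]; rfl
    simpa [e] using this

theorem isTorsionClass_fg [IsNoetherianRing Λ] : IsTorsionClass Λ {M | FG Λ M} := by
  have : {M | FG Λ M} = lPerp Λ ∅ := by ext; simp [lPerp]
  rw [this]; exact isTorsionClass_lPerp _

theorem isTorsionClass_sInter {S : Set (Set (ModuleCat.{0} Λ))} (hne : S.Nonempty)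
    (h : ∀ T ∈ S, IsTorsionClass Λ T) : IsTorsionClass Λ (⋂₀ S) := by
  refine ⟨?_, ?_, ?_, ?_, ?_⟩
  · obtain ⟨T, hT⟩ := hne
    exact fun M hM => (h T hT).1 M (hM T hT)
  · exact fun M N e hM T hT => (h T hT).2.1 e (hM T hT)
  · exact fun M hM T hT => (h T hT).2.2.1 M hM
  · exact fun M N g hg hM T hT => (h T hT).2.2.2.1 g hg (hM T hT)
  · exact fun A M B f g hf hg e hA hB T hT => (h T hT).2.2.2.2 f g hf hg e (hA T hT) (hB T hT)

theorem isTorsionClass_sUnion {S : Set (Set (ModuleCat.{0} Λ))} (hne : S.Nonempty)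
    (hS : DirectedOn (· ⊆ ·) S) (h : ∀ T ∈ S, IsTorsionClass Λ T) :
    IsTorsionClass Λ (⋃₀ S) := by
  refine ⟨?_, ?_, ?_, ?_, ?_⟩
  · rintro M ⟨T, hT, hM⟩; exact (h T hT).1 M hM
  · rintro M N e ⟨T, hT, hM⟩; exact ⟨T, hT, (h T hT).2.1 e hM⟩
  · obtain ⟨T, hT⟩ := hne
    exact fun M hM => ⟨T, hT, (h T hT).2.2.1 M hM⟩
  · rintro M N g hg ⟨T, hT, hM⟩; exact ⟨T, hT, (h T hT).2.2.2.1 g hg hM⟩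
  · rintro A M B f g hf hg e ⟨T₁, hT₁, hA⟩ ⟨T₂, hT₂, hB⟩
    obtain ⟨T, hT, h1, h2⟩ := hS T₁ hT₁ T₂ hT₂
    exact ⟨T, hT, (h T hT).2.2.2.2 f g hf hg e (h1 hA) (h2 hB)⟩

theorem isTorsionClass_torsClosure [IsNoetherianRing Λ] {S : Set (ModuleCat.{0} Λ)}
    (hS : ∀ M ∈ S, FG Λ M) : IsTorsionClass Λ (torsClosure Λ S) :=
  isTorsionClass_sInter ⟨_, isTorsionClass_fg, hS⟩ fun _ h => h.1

theorem subset_torsClosure (S : Set (ModuleCat.{0} Λ)) : S ⊆ torsClosure Λ S :=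
  fun _ hM _ hT => hT.2 hM

theorem torsClosure_subset {S : Set (ModuleCat.{0} Λ)} (hT : IsTorsionClass Λ T) (h : S ⊆ T) :
    torsClosure Λ S ⊆ T :=
  fun _ hM => hM T ⟨hT, h⟩

/-- A nonzero module of `T(S)` receives a nonzero map from a member of `S`. -/
theorem exists_ne_zero_of_mem_torsClosure {S : Set (ModuleCat.{0} Λ)} (hS : ∀ M ∈ S, FG Λ M)
    [Nontrivial X] (hX : In (torsClosure Λ S) X) :
    ∃ N ∈ S, ∃ f : N →ₗ[Λ] X, f ≠ 0 := by
  by_contra! h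
  have h1 := hX _ ⟨isTorsionClass_lPerp {ModuleCat.of Λ X}, fun N hN => ⟨hS N hN, ?_⟩⟩
  · have h2 := h1.2 _ rfl LinearMap.id
    obtain ⟨x, hx⟩ := exists_ne (0 : X)
    exact hx (LinearMap.congr_fun h2 x)
  · rintro _ rfl f
    exact h N hN f

/-- `X` is torsion-free with respect to `T`. -/
def TF (T : Set (ModuleCat.{0} Λ)) (X : Type) [AddCommGroup X] [Module Λ X] : Prop :=
  ∀ (Y : Type) [AddCommGroup Y] [Module Λ Y], In T Y → ∀ f : Y →ₗ[Λ] X, f = 0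

theorem TF.of_injective (hX : TF T X) (f : Y →ₗ[Λ] X) (hf : Injective f) : TF T Y := by
  intro Z _ _ hZ g
  have := hX Z hZ (f ∘ₗ g)
  ext z
  exact hf (by simpa using LinearMap.congr_fun this z)

theorem TF.of_ker (g : M →ₗ[Λ] B) (hA : TF T (LinearMap.ker g)) (hB : TF T B) : TF T M := by
  intro Z _ _ hZ f
  have h1 := hB Z hZ (g ∘ₗ f)
  have h2 := hA Z hZ (f.codRestrict _ fun z => LinearMap.congr_fun h1 z)
  ext z
  exact congrArg Subtype.val (LinearMap.congr_fun h2 z)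

theorem TF.mono {T' : Set (ModuleCat.{0} Λ)} (h : T' ⊆ T) (hX : TF T X) : TF T' X :=
  fun Y _ _ hY f => hX Y (h hY) f

theorem TF.subsingleton (hX : TF T X) (h : In T X) : Subsingleton X :=
  ⟨fun a b => by
    have := hX X h LinearMap.id
    rw [show a = 0 from LinearMap.congr_fun this a, show b = 0 from LinearMap.congr_fun this b]⟩

/-- If `T₁ ⊈ T₂` there is a nonzero module in `T₁` which is torsion-free for `T₂`, and one of
minimal length has only surjective nonzero maps from `T₁`. -/
theorem exists_minimal_module [IsArtinianRing Λ] {T₁ T₂ : Set (ModuleCat.{0} Λ)}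
    (h₁ : IsTorsionClass Λ T₁) (h₂ : IsTorsionClass Λ T₂) (h : ¬ T₁ ⊆ T₂) :
    ∃ B : ModuleCat.{0} Λ, In T₁ B ∧ Nontrivial B ∧ TF T₂ B ∧
      ∀ (X : Type) [AddCommGroup X] [Module Λ X], In T₁ X → ∀ f : X →ₗ[Λ] B, f ≠ 0 →
        Surjective f := by
  obtain ⟨M, hM, hM'⟩ := Set.not_subset.1 h
  have : Module.Finite Λ M := h₁.1 _ hM
  obtain ⟨S, hS, hS'⟩ := h₂.exists_torsion_submodule M
  have hne : {B : ModuleCat.{0} Λ | In T₁ B ∧ Nontrivial B ∧ TF T₂ B}.Nonempty := by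
    refine ⟨ModuleCat.of Λ (M ⧸ S), h₁.quot S.mkQ S.mkQ_surjective hM, ?_, hS'⟩
    refine not_subsingleton_iff_nontrivial.1 fun hs => hM' ?_
    exact h₂.of_submodule S hS (h₂.zero (h := hs))
  obtain ⟨B, ⟨hB, hBn, hBf⟩, hmin⟩ :=
    (InvImage.wf (fun B : ModuleCat.{0} Λ => Module.length Λ B)
      (wellFounded_lt (α := ℕ∞))).has_min _ hne
  refine ⟨B, hB, hBn, hBf, fun X _ _ hX f hf => ?_⟩
  by_contra hs
  have : Module.Finite Λ B := h₁.1 _ hB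
  refine hmin (ModuleCat.of Λ (LinearMap.range f)) ⟨h₁.range f hX, ?_, ?_⟩ ?_
  · refine not_subsingleton_iff_nontrivial.1 fun hs => hf ?_
    have : LinearMap.range f = ⊥ := (Submodule.subsingleton_iff_eq_bot).1 hs
    rwa [LinearMap.range_eq_bot] at this
  · exact hBf.of_injective (LinearMap.range f).subtype (Submodule.injective_subtype _)
  · exact Submodule.length_lt fun h => hs (LinearMap.range_eq_top.1 h)

theorem isBrick_of_surjective [IsArtinianRing Λ] {B : ModuleCat.{0} Λ} [Module.Finite Λ B]
    [Nontrivial B] (h : ∀ f : B →ₗ[Λ] B, f ≠ 0 → Surjective f) : IsBrick Λ B :=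
  ⟨inferInstance, inferInstance, fun f hf =>
    ⟨IsNoetherian.injective_of_surjective_endomorphism f (h f hf), h f hf⟩⟩

/-- A torsion class is determined by its bricks. -/
theorem subset_of_bricks [IsArtinianRing Λ] {T₁ T₂ : Set (ModuleCat.{0} Λ)}
    (h₁ : IsTorsionClass Λ T₁) (h₂ : IsTorsionClass Λ T₂)
    (h : ∀ B, IsBrick Λ B → B ∈ T₁ → B ∈ T₂) : T₁ ⊆ T₂ := by
  by_contra hn
  obtain ⟨B, hB, hBn, hBf, hs⟩ := exists_minimal_module h₁ h₂ hn
  have : Module.Finite Λ B := h₁.1 _ hB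
  have hb := isBrick_of_surjective (hs B hB)
  have := hBf.subsingleton (h B hb hB)
  exact not_subsingleton B this

end TorsionTheory

section Covers

variable {Λ : Type} [Ring Λ] {T : Set (ModuleCat.{0} Λ)}
variable {A B C M N X Y : Type} [AddCommGroup A] [Module Λ A] [AddCommGroup B] [Module Λ B]
  [AddCommGroup C] [Module Λ C] [AddCommGroup M] [Module Λ M] [AddCommGroup N] [Module Λ N]
  [AddCommGroup X] [Module Λ X] [AddCommGroup Y] [Module Λ Y]

variable (Λ) in
/-- The poset of torsion classes. -/
abbrev Tors : Type 1 := {T : Set (ModuleCat.{0} Λ) // IsTorsionClass Λ T}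

/-- A module of `T` all of whose incoming nonzero maps from `T` are surjective with kernel in `T`;
these label the torsion classes covered by `T`. -/
structure IsLabel (T : Set (ModuleCat.{0} Λ)) (B : Type) [AddCommGroup B] [Module Λ B] :
    Prop where
  mem : In T B
  nontrivial : Nontrivial B
  surjective : ∀ (X : Type) [AddCommGroup X] [Module Λ X], In T X → ∀ g : X →ₗ[Λ] B, g ≠ 0 →
    Surjective g
  ker_mem : ∀ (X : Type) [AddCommGroup X] [Module Λ X], In T X → ∀ g : X →ₗ[Λ] B,
    In T (LinearMap.ker g)

/-- The modules of `T` without nonzero maps to `B`. -/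
def noMaps (T : Set (ModuleCat.{0} Λ)) (B : Type) [AddCommGroup B] [Module Λ B] :
    Set (ModuleCat.{0} Λ) :=
  {X | X ∈ T ∧ ∀ g : X →ₗ[Λ] B, g = 0}

theorem isTorsionClass_noMaps (hT : IsTorsionClass Λ T) : IsTorsionClass Λ (noMaps T B) := by
  have : noMaps T B = ⋂₀ {T, lPerp Λ {ModuleCat.of Λ B}} := by
    ext X
    simp only [noMaps, Set.mem_ofPred_eq, Set.sInter_insert, Set.sInter_singleton, Set.mem_inter_iff,
      lPerp, Set.mem_singleton_iff, forall_eq]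
    exact ⟨fun h => ⟨h.1, hT.1 _ h.1, h.2⟩, fun h => ⟨h.1, h.2.2⟩⟩
  rw [this]
  refine isTorsionClass_sInter ⟨T, by simp⟩ ?_
  rintro _ (rfl | rfl)
  exacts [hT, isTorsionClass_lPerp _]

theorem noMaps_subset : noMaps T B ⊆ T := fun _ h => h.1

theorem IsLabel.not_mem_noMaps (hB : IsLabel T B) : ¬ In (noMaps T B) B := fun h => by
  have := hB.nontrivial
  obtain ⟨b, hb⟩ := exists_ne (0 : B)
  exact hb (LinearMap.congr_fun (h.2 LinearMap.id) b)

/-- A torsion-free part of the kernel of a surjection can be split off by passing to quotients. -/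
theorem IsTorsionClass.ker_mem [IsNoetherianRing Λ] (hT : IsTorsionClass Λ T) (hX : In T X)
    (g : X →ₗ[Λ] B) (hg : Surjective g)
    (split : ∀ (Y : Type) [AddCommGroup Y] [Module Λ Y], In T Y → ∀ g : Y →ₗ[Λ] B,
      Surjective g → TF T (LinearMap.ker g) → LinearMap.ker g = ⊥) : In T (LinearMap.ker g) := by
  have := hT.finite hX
  obtain ⟨S, hS, hSf⟩ := hT.exists_torsion_submodule (LinearMap.ker g)
  let S' : Submodule Λ X := S.map (LinearMap.ker g).subtype
  have hle : S' ≤ LinearMap.ker g := Submodule.map_subtype_le _ _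
  let g' := S'.liftQ g hle
  have hcm : Submodule.comap (LinearMap.ker g).subtype S' = S :=
    Submodule.comap_map_eq_of_injective (Submodule.injective_subtype _) S
  have key := split (X ⧸ S') (hT.quot S'.mkQ S'.mkQ_surjective hX) g'
    (fun b => by obtain ⟨x, rfl⟩ := hg b; exact ⟨S'.mkQ x, rfl⟩) (by
      let q : LinearMap.ker g →ₗ[Λ] LinearMap.ker g' :=
        (S'.mkQ ∘ₗ (LinearMap.ker g).subtype).codRestrict _ fun x => x.2
      have hq : Surjective q := by
        rintro ⟨y, hy⟩
        obtain ⟨x, rfl⟩ := S'.mkQ_surjective y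
        exact ⟨⟨x, hy⟩, rfl⟩
      have hkq : LinearMap.ker q = S := by
        rw [← hcm]; ext x
        exact Subtype.ext_iff.trans (Submodule.Quotient.mk_eq_zero S')
      let e := q.quotKerEquivOfSurjective hq
      rw [hkq] at e
      exact TF.of_injective hSf e.symm.toLinearMap e.symm.injective)
  have hkS : LinearMap.ker g ≤ S' := fun x hx => by
    have : S'.mkQ x ∈ LinearMap.ker g' := hx
    rw [key] at this
    simpa using this
  have hST : S = ⊤ := by
    rw [← hcm, Submodule.comap_subtype_eq_top.2 hkS]
  subst hST
  exact hT.equiv Submodule.topEquiv hS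

/-- Every torsion class covered by `T` is cut out by a label. -/
theorem exists_label_of_covBy [IsArtinianRing Λ] {T T' : Tors Λ} (h : T' ⋖ T) :
    ∃ B : ModuleCat.{0} Λ, IsLabel T.1 B ∧ TF T'.1 B ∧ T'.1 = noMaps T.1 B := by
  have hT := T.2
  have hT' := T'.2
  obtain ⟨B, hB, hBn, hBf, hs⟩ := exists_minimal_module hT hT' (not_le_of_gt h.lt)
  have hBT' : ¬ In T'.1 B := fun hn => not_subsingleton B (hBf.subsingleton hn)
  have hBfin : Module.Finite Λ B := hT.1 _ hB
  have hcov : ∀ {U : Set (ModuleCat.{0} Λ)}, IsTorsionClass Λ U → T'.1 ⊆ U → U ⊆ T.1 →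
      U = T'.1 ∨ U = T.1 := fun {U} hU h1 h2 => by
    simpa only [Subtype.ext_iff] using h.eq_or_eq (c := ⟨U, hU⟩) h1 h2
  have split : ∀ (Y : Type) [AddCommGroup Y] [Module Λ Y], In T.1 Y → ∀ g : Y →ₗ[Λ] B,
      Surjective g → TF T.1 (LinearMap.ker g) → LinearMap.ker g = ⊥ := by
    intro Y _ _ hY g hg hK
    have hYf : TF T'.1 Y := TF.of_ker g (hK.mono h.lt.le) hBf
    let S : Set (ModuleCat.{0} Λ) := T'.1 ∪ {B}
    have hS : ∀ M ∈ S, FG Λ M := by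
      rintro M (hM | rfl)
      exacts [hT'.1 _ hM, hBfin]
    have hST : torsClosure Λ S = T.1 := by
      refine (hcov (isTorsionClass_torsClosure hS)
        (Set.subset_union_left.trans (subset_torsClosure S)) (torsClosure_subset hT ?_)).resolve_left
        fun h => hBT' ?_
      · rintro M (hM | rfl)
        exacts [h.lt.le hM, hB]
      · exact h ▸ subset_torsClosure S (Or.inr rfl)
    have hYn : Nontrivial Y := hg.nontrivial
    obtain ⟨N, hN, f, hf⟩ := exists_ne_zero_of_mem_torsClosure hS (X := Y) (hST ▸ hY)
    rcases hN with hN | rfl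
    · exact absurd (hYf N hN f) hf
    · have hgf : g ∘ₗ f ≠ 0 := fun h0 => hf <| by
        have := hK N hB (f.codRestrict _ fun z => LinearMap.congr_fun h0 z)
        ext z
        exact congrArg Subtype.val (LinearMap.congr_fun this z)
      have hsurj := hs N hB _ hgf
      have hinj := IsNoetherian.injective_of_surjective_endomorphism (g ∘ₗ f) hsurj
      let e := LinearEquiv.ofBijective (g ∘ₗ f) ⟨hinj, hsurj⟩
      let p : Y →ₗ[Λ] LinearMap.ker g :=
        (LinearMap.id - f ∘ₗ e.symm.toLinearMap ∘ₗ g).codRestrict _ fun y => by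
          have : g (f (e.symm (g y))) = g y := e.apply_symm_apply (g y)
          simp [this]
      have hp : Surjective p := fun ⟨y, hy⟩ => ⟨y, Subtype.ext (by
        have : g y = 0 := hy
        simp [p, this])⟩
      have := hK.subsingleton (hT.quot p hp hY)
      exact (Submodule.subsingleton_iff_eq_bot).1 this
  refine ⟨B, ⟨hB, hBn, hs, ?_⟩, hBf, ?_⟩
  · intro X _ _ hX g
    by_cases hg : g = 0
    · subst hg; rw [LinearMap.ker_zero]; exact hT.equiv Submodule.topEquiv.symm hX
    exact hT.ker_mem hX g (hs X hX g hg) split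
  · refine ((hcov (isTorsionClass_noMaps hT) (fun X hX => ⟨h.lt.le hX, fun g => ?_⟩)
      noMaps_subset).resolve_right fun hn => ?_).symm
    · exact hBf X hX g
    · obtain ⟨b, hb⟩ := exists_ne (0 : B)
      have hB' : B ∈ noMaps T.1 B := by rw [hn]; exact hB
      exact hb (LinearMap.congr_fun (hB'.2 LinearMap.id) b)

theorem finite_covBy_of_wellFoundedLT [IsArtinianRing Λ] [WellFoundedLT (Tors Λ)] (T : Tors Λ) :
    {T' | T' ⋖ T}.Finite := by
  classical
  have hT := T.2
  let I : Finset (Tors Λ) → Tors Λ := fun s => ⟨⋂₀ insert T.1 (Subtype.val '' (s : Set (Tors Λ))),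
    isTorsionClass_sInter ⟨_, Set.mem_insert _ _⟩ (by
      rintro U (rfl | ⟨U, _, rfl⟩)
      exacts [hT, U.2])⟩
  obtain ⟨s, hs, hmin⟩ := (InvImage.wf I (wellFounded_lt (α := Tors Λ))).has_min
    {s : Finset (Tors Λ) | ∀ U ∈ s, U ⋖ T} ⟨∅, by simp⟩
  refine s.finite_toSet.subset fun T' hT' => ?_
  by_contra hTs
  have hTs : T' ∉ s := hTs
  obtain ⟨B, hB, hBf, hTB⟩ := exists_label_of_covBy hT'
  have hBI : B ∈ (I s).1 := by
    rintro _ (rfl | ⟨U, hU, rfl⟩)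
    · exact hB.mem
    by_contra hBU
    obtain ⟨B', hB', hBf', hUB'⟩ := exists_label_of_covBy (hs U hU)
    rw [hUB'] at hBU
    have : ∃ g : B →ₗ[Λ] B', g ≠ 0 := by
      by_contra! hg
      exact hBU ⟨hB.mem, hg⟩
    obtain ⟨g, hg⟩ := this
    have hgs := hB'.surjective B hB.mem g hg
    have hker : LinearMap.ker g = ⊥ := by
      by_contra hne
      have h1 := hB.surjective (LinearMap.ker g) (hB'.ker_mem B hB.mem g)
        (LinearMap.ker g).subtype fun h0 => hne <| by
          rw [← Submodule.range_subtype (LinearMap.ker g), h0, LinearMap.range_zero]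
      refine hg (LinearMap.ker_eq_top.1 ?_)
      rw [← Submodule.range_subtype (LinearMap.ker g)]
      exact LinearMap.range_eq_top.2 h1
    let e := LinearEquiv.ofBijective g ⟨LinearMap.ker_eq_bot.1 hker, hgs⟩
    have : T' = U := Subtype.ext <| by
      rw [hTB, hUB']
      ext X
      refine and_congr_right fun _ => ⟨fun h f => ?_, fun h f => ?_⟩
      · ext x
        have := LinearMap.congr_fun (h (e.symm.toLinearMap ∘ₗ f)) x
        simpa using this
      · ext x
        have := LinearMap.congr_fun (h (e.toLinearMap ∘ₗ f)) x
        simpa using this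
    exact hTs (this ▸ hU)
  refine hmin (insert T' s) ?_ ?_
  · intro U hU
    rcases Finset.mem_insert.1 hU with rfl | hU
    exacts [hT', hs U hU]
  · refine lt_of_le_of_ne (fun X hX => ?_) fun heq => ?_
    · rintro _ (rfl | ⟨U, hU, rfl⟩)
      · exact hX _ (Or.inl rfl)
      · exact hX _ (Or.inr ⟨U, by simp [Finset.mem_coe.1 hU], rfl⟩)
    · rw [← heq] at hBI
      have h1 : B ∈ T'.1 := hBI _ (Or.inr ⟨T', by simp, rfl⟩)
      rw [hTB] at h1
      exact hB.not_mem_noMaps h1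

end Covers

section Approximation

variable {Λ : Type} [Ring Λ] {T : Set (ModuleCat.{0} Λ)}
variable {A B C M N X Y : Type} [AddCommGroup A] [Module Λ A] [AddCommGroup B] [Module Λ B]
  [AddCommGroup C] [Module Λ C] [AddCommGroup M] [Module Λ M] [AddCommGroup N] [Module Λ N]
  [AddCommGroup X] [Module Λ X] [AddCommGroup Y] [Module Λ Y]

/-- Spaces of module homomorphisms are finitely generated over the base field, and so over the
endomorphism rings. -/
theorem exists_hom_generators (K : Type) [Field K] [Algebra K Λ] [FiniteDimensional K Λ]
    [Module.Finite Λ X] [Module.Finite Λ Y] :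
    ∃ (r : ℕ) (v : Fin r → X →ₗ[Λ] Y),
      (∀ w : X →ₗ[Λ] Y, ∃ a : Fin r → X →ₗ[Λ] X, w = ∑ i, v i ∘ₗ a i) ∧
      ∀ w : X →ₗ[Λ] Y, ∃ a : Fin r → Y →ₗ[Λ] Y, w = ∑ i, a i ∘ₗ v i := by
  let _ : Module K X := Module.compHom X (algebraMap K Λ)
  let _ : Module K Y := Module.compHom Y (algebraMap K Λ)
  have : IsScalarTower K Λ X := ⟨fun a b x => by
    rw [Algebra.smul_def, mul_smul]; rfl⟩
  have : IsScalarTower K Λ Y := ⟨fun a b x => by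
    rw [Algebra.smul_def, mul_smul]; rfl⟩
  have : SMulCommClass Λ K X := IsScalarTower.to_smulCommClass'
  have : SMulCommClass Λ K Y := IsScalarTower.to_smulCommClass'
  have : Module.Finite K X := Module.Finite.trans Λ X
  have : Module.Finite K Y := Module.Finite.trans Λ Y
  have : Module.Finite K (X →ₗ[Λ] Y) :=
    Module.Finite.of_injective (LinearMap.restrictScalarsₗ K Λ X Y K)
      (LinearMap.restrictScalars_injective K)
  obtain ⟨r, v, hv⟩ := Module.Finite.exists_fin (R := K) (M := X →ₗ[Λ] Y)
  have key : ∀ w : X →ₗ[Λ] Y, ∃ c : Fin r → K, ∑ i, c i • v i = w := fun w =>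
    (Submodule.mem_span_range_iff_exists_fun K).1 (hv ▸ Submodule.mem_top)
  refine ⟨r, v, fun w => ?_, fun w => ?_⟩
  · obtain ⟨c, rfl⟩ := key w
    refine ⟨fun i => c i • LinearMap.id, Finset.sum_congr rfl fun i _ => ?_⟩
    ext x
    simp only [LinearMap.smul_apply, LinearMap.comp_apply, LinearMap.id_apply]
    exact ((v i).map_smul (algebraMap K Λ (c i)) x).symm
  · obtain ⟨c, rfl⟩ := key w
    exact ⟨fun i => c i • LinearMap.id, Finset.sum_congr rfl fun i _ => by ext x; simp⟩

theorem IsTorsionClass.pi_finite (hT : IsTorsionClass Λ T) (hM : In T M) (ι : Type) [Finite ι] :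
    In T (ι → M) := by
  obtain ⟨n, ⟨e⟩⟩ := Finite.exists_equiv_fin ι
  exact hT.equiv (LinearEquiv.funCongrLeft Λ M e) (hT.pi hM n)

/-- Every member of `T` is a quotient of a finite power of a fixed member of `T`. -/
def IsFac (T : Set (ModuleCat.{0} Λ)) : Prop :=
  ∃ M : ModuleCat.{0} Λ, M ∈ T ∧ ∀ (X : Type) [AddCommGroup X] [Module Λ X], In T X →
    ∃ (ι : Type) (_ : Finite ι) (g : (ι → M) →ₗ[Λ] X), Surjective g

/-- A minimal left `T`-approximation of the regular module, given by an element `m`. -/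
structure IsGeneric (T : Set (ModuleCat.{0} Λ)) (m : M) : Prop where
  mem : In T M
  exists_map : ∀ (Y : Type) [AddCommGroup Y] [Module Λ Y], In T Y → ∀ y : Y,
    ∃ h : M →ₗ[Λ] Y, h m = y
  bijective : ∀ r : M →ₗ[Λ] M, r m = m → Bijective r

theorem IsFac.exists_isGeneric (K : Type) [Field K] [Algebra K Λ] [FiniteDimensional K Λ]
    (hT : IsTorsionClass Λ T) (h : IsFac T) :
    ∃ (M : ModuleCat.{0} Λ) (m : M), IsGeneric T m := by
  classical
  have : IsArtinianRing Λ := IsArtinianRing.of_finite K Λ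
  obtain ⟨M, hM, hfac⟩ := h
  have : Module.Finite Λ M := hT.1 _ hM
  obtain ⟨r, v, -, hv⟩ := exists_hom_generators (Λ := Λ) K (X := Λ) (Y := M)
  have hne : {p : Σ M : ModuleCat.{0} Λ, M | In T p.1 ∧
      ∀ (Y : Type) [AddCommGroup Y] [Module Λ Y], In T Y → ∀ y : Y,
        ∃ h : p.1 →ₗ[Λ] Y, h p.2 = y}.Nonempty := by
    refine ⟨⟨ModuleCat.of Λ (Fin r → M), fun i => v i 1⟩, hT.pi hM r, fun Y _ _ hY y => ?_⟩
    have hmem : ∀ x : M, ∃ h : (Fin r → M) →ₗ[Λ] M, h (fun i => v i 1) = x := fun x => by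
      obtain ⟨a, ha⟩ := hv (LinearMap.toSpanSingleton Λ M x)
      refine ⟨∑ i, a i ∘ₗ LinearMap.proj i, ?_⟩
      simpa using (LinearMap.congr_fun ha 1).symm
    obtain ⟨ι, _, g, hg⟩ := hfac Y hY
    obtain ⟨z, rfl⟩ := hg y
    choose k hk using fun i => hmem (z i)
    exact ⟨g ∘ₗ LinearMap.pi k, congrArg g (funext hk)⟩
  obtain ⟨⟨M₀, m₀⟩, ⟨h1, h2⟩, hmin⟩ :=
    (InvImage.wf (fun p : Σ M : ModuleCat.{0} Λ, M => Module.length Λ p.1)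
      (wellFounded_lt (α := ℕ∞))).has_min _ hne
  have : Module.Finite Λ M₀ := hT.1 _ h1
  refine ⟨M₀, m₀, h1, h2, fun f hf => ?_⟩
  have hs : Surjective f := by
    by_contra hs
    refine hmin ⟨ModuleCat.of Λ (LinearMap.range f), ⟨m₀, m₀, hf⟩⟩ ⟨hT.range f h1, ?_⟩
      (Submodule.length_lt fun h => hs (LinearMap.range_eq_top.1 h))
    intro Y _ _ hY y
    obtain ⟨k, hk⟩ := h2 Y hY y
    exact ⟨k ∘ₗ (LinearMap.range f).subtype, hk⟩
  exact ⟨IsNoetherian.injective_of_surjective_endomorphism f hs, hs⟩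

/-- `Q` has the lifting property against surjections with kernel in `T`. -/
def Lifts (T : Set (ModuleCat.{0} Λ)) (Q : Type) [AddCommGroup Q] [Module Λ Q] : Prop :=
  ∀ (E C : Type) [AddCommGroup E] [Module Λ E] [AddCommGroup C] [Module Λ C] (p : E →ₗ[Λ] C),
    Surjective p → In T (LinearMap.ker p) → ∀ h : Q →ₗ[Λ] C, ∃ k : Q →ₗ[Λ] E, p ∘ₗ k = h

theorem Lifts.prod (hM : Lifts T M) (hN : Lifts T N) : Lifts T (M × N) := by
  intro E C _ _ _ _ p hp hK h
  obtain ⟨k, hk⟩ := hM E C p hp hK (h ∘ₗ LinearMap.inl Λ M N)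
  obtain ⟨l, hl⟩ := hN E C p hp hK (h ∘ₗ LinearMap.inr Λ M N)
  refine ⟨k.coprod l, ?_⟩
  rw [LinearMap.comp_coprod, hk, hl, ← LinearMap.comp_coprod, LinearMap.coprod_inl_inr,
    LinearMap.comp_id]

theorem Lifts.pi (hM : Lifts T M) (ι : Type) [Finite ι] : Lifts T (ι → M) := by
  classical
  have := Fintype.ofFinite ι
  intro E C _ _ _ _ p hp hK h
  choose k hk using fun i => hM E C p hp hK (h ∘ₗ LinearMap.single Λ (fun _ => M) i)
  refine ⟨∑ i, k i ∘ₗ LinearMap.proj i, ?_⟩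
  refine LinearMap.pi_ext' fun i => ?_
  rw [← hk i]
  ext x
  simp [Pi.single_apply, apply_ite]

theorem IsGeneric.lifts (hT : IsTorsionClass Λ T) {m : M} (hm : IsGeneric T m) :
    Lifts T M := by
  intro E C _ _ _ _ p hp hK h
  let S : Submodule Λ (E × M) := LinearMap.eqLocus (p ∘ₗ LinearMap.fst Λ E M)
    (h ∘ₗ LinearMap.snd Λ E M)
  have hS : In T S := by
    refine hT.ext (((LinearMap.inl Λ E M) ∘ₗ (LinearMap.ker p).subtype).codRestrict S fun x => ?_)
      (LinearMap.snd Λ E M ∘ₗ S.subtype) ?_ ?_ ?_ hK hm.mem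
    · have : p x = 0 := x.2
      simp [S, LinearMap.mem_eqLocus, this]
    · intro x y hxy
      have := congrArg (fun z : S => z.1.1) hxy
      exact Subtype.ext this
    · intro y
      obtain ⟨e, he⟩ := hp (h y)
      exact ⟨⟨(e, y), he⟩, rfl⟩
    · ext ⟨⟨e, y⟩, hy⟩
      have hy : p e = h y := hy
      simp only [LinearMap.mem_range, LinearMap.mem_ker]
      constructor
      · rintro ⟨x, hx⟩
        exact (congrArg (fun z : S => z.1.2) hx).symm
      · intro h0
        have h0 : y = 0 := h0
        subst h0
        exact ⟨⟨e, by simpa using hy⟩, rfl⟩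
  obtain ⟨e₀, he₀⟩ := hp (h m)
  obtain ⟨k, hk⟩ := hm.exists_map S hS ⟨(e₀, m), he₀⟩
  let r : M →ₗ[Λ] M := LinearMap.snd Λ E M ∘ₗ S.subtype ∘ₗ k
  have hr := hm.bijective r (by simp [r, hk])
  let e := LinearEquiv.ofBijective r hr
  refine ⟨LinearMap.fst Λ E M ∘ₗ S.subtype ∘ₗ k ∘ₗ e.symm.toLinearMap, ?_⟩
  ext x
  have h1 : p (k (e.symm x)).1.1 = h (k (e.symm x)).1.2 := (k (e.symm x)).2
  have h2 : (k (e.symm x)).1.2 = x := e.apply_symm_apply x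
  simpa [h2] using h1

theorem IsGeneric.lifts_quotient (hT : IsTorsionClass Λ T) {m : M} (hm : IsGeneric T m) :
    Lifts T (M ⧸ Submodule.span Λ {m}) := by
  intro E C _ _ _ _ p hp hK h
  obtain ⟨k, hk⟩ := hm.lifts hT E C p hp hK (h ∘ₗ Submodule.mkQ _)
  have hkm : p (k m) = 0 := by
    have := LinearMap.congr_fun hk m
    simp only [LinearMap.comp_apply] at this
    rw [this, (Submodule.Quotient.mk_eq_zero _).2 (Submodule.mem_span_singleton_self m) |>
      fun h : Submodule.mkQ (Submodule.span Λ {m}) m = 0 => h, map_zero]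
  obtain ⟨j, hj⟩ := hm.exists_map _ hK ⟨k m, hkm⟩
  refine ⟨Submodule.liftQ _ (k - (LinearMap.ker p).subtype ∘ₗ j) ?_, ?_⟩
  · rw [Submodule.span_le, Set.singleton_subset_iff]
    simp [hj]
  · refine Submodule.linearMap_qext _ ?_
    rw [← hk]
    ext x
    have : p (j x) = 0 := (j x).2
    simp [this]

/-- A torsion class of the form `Fac` has a generator with the lifting property, and every member
has a presentation by it inside the torsion class. -/
theorem IsFac.exists_presentation (K : Type) [Field K] [Algebra K Λ] [FiniteDimensional K Λ]
    (hT : IsTorsionClass Λ T) (h : IsFac T) :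
    ∃ P : ModuleCat.{0} Λ, P ∈ T ∧ Lifts T P ∧
      ∀ (Y : Type) [AddCommGroup Y] [Module Λ Y], In T Y →
        ∃ (ι : Type) (_ : Finite ι) (q : (ι → P) →ₗ[Λ] Y), Surjective q ∧
          In T (LinearMap.ker q) := by
  classical
  have : IsArtinianRing Λ := IsArtinianRing.of_finite K Λ
  obtain ⟨M, m, hm⟩ := h.exists_isGeneric K hT
  let R := M ⧸ Submodule.span Λ {m}
  have hR : In T R := hT.quot _ (Submodule.mkQ_surjective _) hm.mem
  have hRfin := hT.finite hR
  have hP : In T (M × R) := hT.prod hm.mem hR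
  refine ⟨ModuleCat.of Λ (M × R), hP, (hm.lifts hT).prod (hm.lifts_quotient hT), ?_⟩
  intro Y _ _ hY
  have hYfin := hT.finite hY
  obtain ⟨n, y, hy⟩ := Module.Finite.exists_fin (R := Λ) (M := Y)
  choose u hu using fun i => hm.exists_map Y hY (y i)
  obtain ⟨r, v, hv, -⟩ := exists_hom_generators (Λ := Λ) K (X := R) (Y := Y)
  let c : Fin n ⊕ Fin r → (M × R) →ₗ[Λ] Y :=
    Sum.elim (fun i => u i ∘ₗ LinearMap.fst Λ M R) (fun i => v i ∘ₗ LinearMap.snd Λ M R)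
  let q : (Fin n ⊕ Fin r → M × R) →ₗ[Λ] Y := LinearMap.lsum Λ (fun _ => M × R) ℕ c
  have hq : ∀ i z, q (Pi.single i z) = c i z := fun i z =>
    LinearMap.lsum_piSingle Λ (fun _ => M × R) ℕ c i z
  refine ⟨Fin n ⊕ Fin r, inferInstance, q, ?_, ?_⟩
  · rw [← LinearMap.range_eq_top, eq_top_iff, ← hy, Submodule.span_le]
    rintro _ ⟨i, rfl⟩
    exact ⟨Pi.single (Sum.inl i) (m, 0), by rw [hq]; exact hu i⟩
  · have hQ := hT.pi_finite hP (Fin n ⊕ Fin r)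
    have := hT.finite hQ
    refine hT.of_forall_mem fun l => ?_
    obtain ⟨j, hj⟩ := hm.exists_map _ hQ l.1
    have hl : q l.1 = 0 := l.2
    obtain ⟨a, ha⟩ := hv (Submodule.liftQ _ (q ∘ₗ j) (by
      rw [Submodule.span_le, Set.singleton_subset_iff]
      simp [hj, hl]))
    let w : R →ₗ[Λ] (Fin n ⊕ Fin r → M × R) := ∑ i,
      LinearMap.single Λ (fun _ => M × R) (Sum.inr i) ∘ₗ LinearMap.inr Λ M R ∘ₗ a i
    have hw : ∀ x, q (w x) = ∑ i, v i (a i x) := fun x => by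
      simp only [w, LinearMap.sum_apply, map_sum]
      refine Finset.sum_congr rfl fun i _ => ?_
      exact hq _ _
    have hw' : ∀ x : M, q (w (Submodule.mkQ _ x)) = q (j x) := fun x => by
      rw [hw]
      have := LinearMap.congr_fun ha (Submodule.mkQ _ x)
      simpa using this.symm
    refine ⟨M, _, _, hm.mem, (j - w ∘ₗ Submodule.mkQ _).codRestrict _ fun x => ?_, m, ?_⟩
    · rw [LinearMap.mem_ker, LinearMap.sub_apply, map_sub, LinearMap.comp_apply, hw', sub_self]
    · refine Subtype.ext ?_
      have h0 : Submodule.mkQ (Submodule.span Λ {m}) m = 0 :=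
        (Submodule.Quotient.mk_eq_zero _).2 (Submodule.mem_span_singleton_self m)
      change j m - w (Submodule.mkQ _ m) = l.1
      rw [h0, map_zero, sub_zero, hj]

end Approximation

section LowerCovers

variable {Λ : Type} [Ring Λ] {T : Set (ModuleCat.{0} Λ)}
variable {A B C M N X Y : Type} [AddCommGroup A] [Module Λ A] [AddCommGroup B] [Module Λ B]
  [AddCommGroup C] [Module Λ C] [AddCommGroup M] [Module Λ M] [AddCommGroup N] [Module Λ N]
  [AddCommGroup X] [Module Λ X] [AddCommGroup Y] [Module Λ Y]

/-- A submodule of `Q` in `T` through which no map to the label factors contains the image of an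
endomorphism of `Q` acting trivially on maps to the label. -/
theorem IsLabel.exists_endomorphism [IsArtinianRing Λ] (hT : IsTorsionClass Λ T)
    (hB : IsLabel T B) (hM : In T M) (hlift : Lifts T M) {L : Submodule Λ M} (hL : In T L)
    (h0 : ∀ g : M →ₗ[Λ] B, L ≤ LinearMap.ker g → g = 0) :
    ∃ e : M →ₗ[Λ] M, (∀ x, e x ∈ L) ∧ ∀ g : M →ₗ[Λ] B, g ∘ₗ e = g := by
  have := hT.finite hM
  have htop : In T (L.comap (⊤ : Submodule Λ M).subtype) :=
    hT.equiv (Submodule.comapSubtypeEquivOfLe le_top).symm hL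
  obtain ⟨S, ⟨hS, hSL, hsup⟩, hmin⟩ :=
    (wellFounded_lt (α := Submodule Λ M)).has_min
      {S | In T S ∧ In T (L.comap S.subtype) ∧ S ⊔ L = ⊤}
      ⟨⊤, hT.equiv Submodule.topEquiv.symm hM, htop, top_sup_eq _⟩
  have hker : ∀ g : M →ₗ[Λ] B, S ≤ LinearMap.ker g := by
    intro g
    by_contra hg
    have hlt : S ⊓ LinearMap.ker g < S := inf_lt_left.2 hg
    refine hmin (S ⊓ LinearMap.ker g) ⟨?_, ?_, ?_⟩ hlt
    · have h1 := hB.ker_mem S hS (g ∘ₗ S.subtype)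
      rw [LinearMap.ker_comp] at h1
      refine hT.equiv ?_ h1
      exact (Submodule.equivSubtypeMap S _).trans (LinearEquiv.ofEq _ _ (by
        rw [Submodule.map_comap_subtype]))
    · have h1 := hB.ker_mem _ hSL (g ∘ₗ S.subtype ∘ₗ (L.comap S.subtype).subtype)
      let f : (LinearMap.ker (g ∘ₗ S.subtype ∘ₗ (L.comap S.subtype).subtype)) →ₗ[Λ]
          L.comap (S ⊓ LinearMap.ker g).subtype :=
        ((S.subtype ∘ₗ (L.comap S.subtype).subtype ∘ₗ Submodule.subtype _).codRestrict
          (S ⊓ LinearMap.ker g) fun x => ⟨x.1.1.2, x.2⟩).codRestrict _ fun x => x.1.2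
      refine hT.quot f ?_ h1
      rintro ⟨⟨x, hx, hgx⟩, hxL⟩
      exact ⟨⟨⟨⟨x, hx⟩, hxL⟩, hgx⟩, rfl⟩
    · have hne : g ∘ₗ S.subtype ∘ₗ (L.comap S.subtype).subtype ≠ 0 := by
        intro hzero
        have hSL0 : ∀ s ∈ S, s ∈ L → g s = 0 := fun s hs hsL =>
          LinearMap.congr_fun hzero ⟨⟨s, hs⟩, hsL⟩
        have hcop : Surjective (S.subtype.coprod L.subtype) := by
          rw [← LinearMap.range_eq_top, LinearMap.range_coprod, Submodule.range_subtype,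
            Submodule.range_subtype, hsup]
        let c : (S × L) →ₗ[Λ] B := g ∘ₗ S.subtype ∘ₗ LinearMap.fst Λ S L
        have hle : LinearMap.ker (S.subtype.coprod L.subtype) ≤ LinearMap.ker c := by
          rintro ⟨s, l⟩ hsl
          have hsl : (s : M) + l = 0 := hsl
          refine hSL0 s s.2 ?_
          rw [eq_neg_of_add_eq_zero_left hsl]
          exact L.neg_mem l.2
        let k : M →ₗ[Λ] B := (LinearMap.ker (S.subtype.coprod L.subtype)).liftQ c hle ∘ₗ
          ((S.subtype.coprod L.subtype).quotKerEquivOfSurjective hcop).symm.toLinearMap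
        have hk : ∀ z : S × L, k (z.1 + z.2) = g z.1 := by
          intro z
          have hz : ((S.subtype.coprod L.subtype).quotKerEquivOfSurjective hcop).symm (z.1 + z.2) =
              Submodule.mkQ _ z := by
            rw [LinearEquiv.symm_apply_eq]; rfl
          simp only [k, LinearMap.comp_apply, LinearEquiv.coe_coe, hz]
          rfl
        have hk0 := h0 k fun l hl => by
          have := hk (0, ⟨l, hl⟩)
          simpa using this
        refine hg fun s hs => ?_
        have := hk (⟨s, hs⟩, 0)
        rw [hk0] at this
        simpa using this.symm
      have hsurj := hB.surjective _ hSL _ hne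
      rw [eq_top_iff, ← hsup]
      refine sup_le (fun s hs => ?_) le_sup_right
      obtain ⟨⟨⟨l, hlS⟩, hlL⟩, hl⟩ := hsurj (g s)
      have hl : g l = g s := hl
      rw [← sub_add_cancel s l]
      refine Submodule.add_mem_sup ⟨S.sub_mem hs hlS, ?_⟩ hlL
      simp [hl]
  have hp : Surjective (S.mkQ ∘ₗ L.subtype) := by
    intro y
    obtain ⟨x, rfl⟩ := S.mkQ_surjective y
    obtain ⟨s, hs, l, hl, rfl⟩ := Submodule.mem_sup.1 (hsup ▸ Submodule.mem_top : x ∈ S ⊔ L)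
    refine ⟨⟨l, hl⟩, ?_⟩
    have : S.mkQ s = 0 := (Submodule.Quotient.mk_eq_zero _).2 hs
    simp [-Submodule.mkQ_apply, this]
  have hKp : In T (LinearMap.ker (S.mkQ ∘ₗ L.subtype)) := by
    let f : L.comap S.subtype →ₗ[Λ] LinearMap.ker (S.mkQ ∘ₗ L.subtype) :=
      ((S.subtype ∘ₗ Submodule.subtype _).codRestrict L fun x => x.2).codRestrict _ fun x =>
        (Submodule.Quotient.mk_eq_zero S).2 x.1.2
    refine hT.quot f ?_ hSL
    rintro ⟨⟨x, hxL⟩, hx⟩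
    exact ⟨⟨⟨x, (Submodule.Quotient.mk_eq_zero S).1 hx⟩, hxL⟩, rfl⟩
  obtain ⟨s, hs⟩ := hlift _ _ _ hp hKp S.mkQ
  refine ⟨L.subtype ∘ₗ s, fun x => (s x).2, fun g => ?_⟩
  ext x
  have h1 : S.mkQ (s x : M) = S.mkQ x := LinearMap.congr_fun hs x
  have h2 := hker g ((Submodule.Quotient.eq S).1 h1)
  rw [LinearMap.mem_ker, map_sub, sub_eq_zero] at h2
  exact h2

/-- Endomorphisms of `X` acting trivially on maps to `B` are injective. -/
def IsRigid (B X : Type) [AddCommGroup B] [Module Λ B] [AddCommGroup X] [Module Λ X] : Prop :=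
  ∀ e : X →ₗ[Λ] X, (∀ g : X →ₗ[Λ] B, g ∘ₗ e = g) → Injective e

theorem IsRigid.equiv (h : IsRigid (Λ := Λ) B X) (f : X ≃ₗ[Λ] Y) : IsRigid (Λ := Λ) B Y := by
  intro e he
  have := h (f.symm.toLinearMap ∘ₗ e ∘ₗ f.toLinearMap) fun g => by
    have := he (g ∘ₗ f.symm.toLinearMap)
    ext x
    simpa using LinearMap.congr_fun this (f x)
  intro x y hxy
  refine f.symm.injective (this ?_)
  simp [hxy]

theorem IsRigid.prod [IsArtinian Λ Y] (hX : IsRigid (Λ := Λ) B X) (hY : IsRigid (Λ := Λ) B Y) :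
    IsRigid (Λ := Λ) B (X × Y) := by
  intro e he
  let a : X →ₗ[Λ] X := LinearMap.fst Λ X Y ∘ₗ e ∘ₗ LinearMap.inl Λ X Y
  let b : Y →ₗ[Λ] X := LinearMap.fst Λ X Y ∘ₗ e ∘ₗ LinearMap.inr Λ X Y
  let c : X →ₗ[Λ] Y := LinearMap.snd Λ X Y ∘ₗ e ∘ₗ LinearMap.inl Λ X Y
  let d : Y →ₗ[Λ] Y := LinearMap.snd Λ X Y ∘ₗ e ∘ₗ LinearMap.inr Λ X Y
  have ha : ∀ (g : X →ₗ[Λ] B) x, g (a x) = g x := fun g x =>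
    LinearMap.congr_fun (he (g ∘ₗ LinearMap.fst Λ X Y)) (x, 0)
  have hb : ∀ (g : X →ₗ[Λ] B) y, g (b y) = 0 := fun g y =>
    (LinearMap.congr_fun (he (g ∘ₗ LinearMap.fst Λ X Y)) (0, y)).trans (map_zero g)
  have hd : ∀ (g : Y →ₗ[Λ] B) y, g (d y) = g y := fun g y =>
    LinearMap.congr_fun (he (g ∘ₗ LinearMap.snd Λ X Y)) (0, y)
  have hdi : Injective d := hY d fun g => LinearMap.ext (hd g)
  let D := LinearEquiv.ofBijective d ⟨hdi, IsArtinian.surjective_of_injective_endomorphism d hdi⟩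
  have hinj : Injective (a - b ∘ₗ D.symm.toLinearMap ∘ₗ c) := hX _ fun g => by
    ext x
    simp [ha, hb]
  have hdec : ∀ x y, e (x, y) = (a x + b y, c x + d y) := fun x y => by
    have : (x, y) = LinearMap.inl Λ X Y x + LinearMap.inr Λ X Y y := by simp
    rw [this, map_add]
    rfl
  refine (injective_iff_map_eq_zero e).2 ?_
  rintro ⟨x, y⟩ hxy
  rw [hdec, Prod.mk_eq_zero] at hxy
  have hy : y = - D.symm (c x) := by
    rw [← map_neg, LinearEquiv.eq_symm_apply]
    exact eq_neg_of_add_eq_zero_right hxy.2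
  have hx : x = 0 := hinj (by
    rw [map_zero, LinearMap.sub_apply, sub_eq_add_neg, ← hxy.1, hy, map_neg]
    rfl)
  rw [hy, hx, map_zero, map_zero, neg_zero]
  rfl

theorem IsRigid.pi [IsArtinian Λ X] (hX : IsRigid (Λ := Λ) B X) (ι : Type) [Finite ι] :
    IsRigid (Λ := Λ) B (ι → X) := by
  obtain ⟨n, ⟨e⟩⟩ := Finite.exists_equiv_fin ι
  refine IsRigid.equiv ?_ (LinearEquiv.funCongrLeft Λ X e)
  clear e
  induction n with
  | zero => exact fun e _ => injective_of_subsingleton e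
  | succ n ih => exact (hX.prod ih).equiv (Fin.consLinearEquiv Λ (fun _ => X))

/-- Split off a largest summand without maps to `B`. -/
theorem exists_rigid_decomposition [IsArtinianRing Λ] [Module.Finite Λ M] :
    ∃ X U : ModuleCat.{0} Λ, Nonempty (M ≃ₗ[Λ] X × U) ∧ (∀ g : U →ₗ[Λ] B, g = 0) ∧
      IsRigid (Λ := Λ) B X := by
  have hne : {p : ModuleCat.{0} Λ × ModuleCat.{0} Λ | Nonempty (M ≃ₗ[Λ] p.1 × p.2) ∧
      ∀ g : p.2 →ₗ[Λ] B, g = 0}.Nonempty := by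
    refine ⟨(ModuleCat.of Λ M, ModuleCat.of Λ PUnit), ⟨LinearEquiv.prodUnique.symm⟩, fun g => ?_⟩
    ext x
    rw [Subsingleton.elim x 0, map_zero, map_zero]
  obtain ⟨⟨X, U⟩, ⟨⟨f⟩, hU⟩, hmin⟩ :=
    (InvImage.wf (fun p : ModuleCat.{0} Λ × ModuleCat.{0} Λ => Module.length Λ p.1)
      (wellFounded_lt (α := ℕ∞))).has_min _ hne
  refine ⟨X, U, ⟨f⟩, hU, fun e he => ?_⟩
  have : Module.Finite Λ X := Module.Finite.of_surjective (LinearMap.fst Λ X U ∘ₗ f.toLinearMap)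
    (Prod.fst_surjective.comp f.surjective)
  obtain ⟨n, hn⟩ := Filter.eventually_atTop.1 e.eventually_isCompl_ker_pow_range_pow
  have hc := hn (n + 1) (Nat.le_succ n)
  have hpow : ∀ (k : ℕ) (g : X →ₗ[Λ] B) x, g ((e ^ k) x) = g x := by
    intro k g
    induction k with
    | zero => intro x; rfl
    | succ k ih => intro x; rw [pow_succ, Module.End.mul_apply, ih]; exact LinearMap.congr_fun (he g) x
  have hker0 : ∀ g : LinearMap.ker (e ^ (n + 1)) →ₗ[Λ] B, g = 0 := fun g => by
    ext x
    have h1 := hpow (n + 1) (g ∘ₗ Submodule.projectionOnto _ _ hc) x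
    have hx : (e ^ (n + 1)) (x : X) = 0 := x.2
    rw [hx, map_zero, LinearMap.comp_apply] at h1
    simpa using h1.symm
  have hrange : LinearMap.range (e ^ (n + 1)) = ⊤ := by
    by_contra hlt
    refine hmin (ModuleCat.of Λ (LinearMap.range (e ^ (n + 1))),
      ModuleCat.of Λ (LinearMap.ker (e ^ (n + 1)) × U)) ⟨⟨?_⟩, fun g => ?_⟩
      (Submodule.length_lt hlt)
    · exact f.trans ((((Submodule.prodEquivOfIsCompl _ _ hc.symm).symm.prodCongr
        (LinearEquiv.refl Λ U))).trans (LinearEquiv.prodAssoc Λ _ _ _))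
    · refine LinearMap.prod_ext ?_ ?_
      · exact hker0 _
      · exact hU _
  have hbot : LinearMap.ker (e ^ (n + 1)) = ⊥ := by
    have := hc.symm
    rw [hrange] at this
    exact this.inf_eq_bot.symm ▸ (top_inf_eq _).symm
  have hinj : Injective (e ^ (n + 1)) := LinearMap.ker_eq_bot.1 hbot
  intro x y hxy
  refine hinj ?_
  rw [pow_succ, Module.End.mul_apply, Module.End.mul_apply, hxy]

/-- The property of being of the form `Fac` passes to lower covers. -/
theorem IsFac.of_covBy (K : Type) [Field K] [Algebra K Λ] [FiniteDimensional K Λ]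
    {T T' : Tors Λ} (h : T' ⋖ T) (hF : IsFac T.1) : IsFac T'.1 := by
  have : IsArtinianRing Λ := IsArtinianRing.of_finite K Λ
  have hT := T.2
  obtain ⟨P, hP, hlift, hpres⟩ := hF.exists_presentation K hT
  obtain ⟨B, hB, hBf, hTB⟩ := exists_label_of_covBy h
  have : Module.Finite Λ P := hT.1 _ hP
  obtain ⟨X, U, ⟨f⟩, hU, hX⟩ := exists_rigid_decomposition (Λ := Λ) (M := P) (B := B)
  have : Module.Finite Λ X := Module.Finite.of_surjective (LinearMap.fst Λ X U ∘ₗ f.toLinearMap)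
    (Prod.fst_surjective.comp f.surjective)
  refine ⟨U, ?_, fun Y _ _ hY => ?_⟩
  · rw [hTB]
    exact ⟨hT.quot (LinearMap.snd Λ X U ∘ₗ f.toLinearMap)
      (Prod.snd_surjective.comp f.surjective) hP, hU⟩
  · obtain ⟨ι, _, q, hq, hker⟩ := hpres Y (h.lt.le hY)
    have hPι := hT.pi_finite hP ι
    obtain ⟨e, heL, he⟩ := hB.exists_endomorphism hT hPι (hlift.pi ι) hker (by
      intro g hg
      have hY0 : ∀ k : Y →ₗ[Λ] B, k = 0 := by
        rw [hTB] at hY; exact hY.2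
      have := hY0 ((LinearMap.ker q).liftQ g hg ∘ₗ
        (q.quotKerEquivOfSurjective hq).symm.toLinearMap)
      ext x
      have h1 := LinearMap.congr_fun this (q x)
      have h2 : (q.quotKerEquivOfSurjective hq).symm (q x) = Submodule.mkQ _ x := by
        rw [LinearEquiv.symm_apply_eq]; rfl
      simpa [h2] using h1)
    let in₁ : (ι → X) →ₗ[Λ] (ι → P) := LinearMap.pi fun i =>
      f.symm.toLinearMap ∘ₗ LinearMap.inl Λ X U ∘ₗ LinearMap.proj i
    let in₂ : (ι → U) →ₗ[Λ] (ι → P) := LinearMap.pi fun i =>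
      f.symm.toLinearMap ∘ₗ LinearMap.inr Λ X U ∘ₗ LinearMap.proj i
    let pr₁ : (ι → P) →ₗ[Λ] (ι → X) := LinearMap.pi fun i =>
      LinearMap.fst Λ X U ∘ₗ f.toLinearMap ∘ₗ LinearMap.proj i
    have hpi : pr₁ ∘ₗ in₁ = LinearMap.id := by
      ext x i
      simp [pr₁, in₁]
    have hex : ∀ z, pr₁ z = 0 → ∃ u, in₂ u = z := fun z hz => by
      refine ⟨fun i => (f (z i)).2, funext fun i => ?_⟩
      have : (f (z i)).1 = 0 := congrFun hz i
      simp only [in₂, LinearMap.pi_apply, LinearMap.comp_apply, LinearMap.proj_apply,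
        LinearMap.inr_apply, LinearEquiv.coe_coe]
      rw [LinearEquiv.symm_apply_eq, ← this]
    have hinj := hX.pi ι (pr₁ ∘ₗ e ∘ₗ in₁) fun g => by
      have h1 := he (g ∘ₗ pr₁)
      calc g ∘ₗ pr₁ ∘ₗ e ∘ₗ in₁ = ((g ∘ₗ pr₁) ∘ₗ e) ∘ₗ in₁ := rfl
        _ = g ∘ₗ pr₁ ∘ₗ in₁ := by rw [h1]; rfl
        _ = g := by rw [hpi, LinearMap.comp_id]
    have hsurj := IsArtinian.surjective_of_injective_endomorphism _ hinj
    refine ⟨ι, inferInstance, q ∘ₗ in₂, fun y => ?_⟩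
    obtain ⟨z, rfl⟩ := hq y
    obtain ⟨x, hx⟩ := hsurj (pr₁ z)
    obtain ⟨u, hu⟩ := hex (z - e (in₁ x)) (by
      rw [map_sub, sub_eq_zero]; exact hx.symm)
    refine ⟨u, ?_⟩
    have h1 : q (e (in₁ x)) = 0 := heL _
    rw [LinearMap.comp_apply, hu, map_sub, h1, sub_zero]

end LowerCovers

section Lattice

variable {Λ : Type} [Ring Λ] {T : Set (ModuleCat.{0} Λ)}
variable {A B C M N X Y : Type} [AddCommGroup A] [Module Λ A] [AddCommGroup B] [Module Λ B]
  [AddCommGroup C] [Module Λ C] [AddCommGroup M] [Module Λ M] [AddCommGroup N] [Module Λ N]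
  [AddCommGroup X] [Module Λ X] [AddCommGroup Y] [Module Λ Y]

theorem exists_tors_iUnion {c : Set (Tors Λ)} (hne : c.Nonempty) (hc : IsChain (· ≤ ·) c) :
    ∃ U : Tors Λ, ∀ X, X ∈ U.1 ↔ ∃ T ∈ c, X ∈ T.1 := by
  refine ⟨⟨⋃₀ (Subtype.val '' c), isTorsionClass_sUnion (hne.image _) ?_ ?_⟩, fun X => by simp⟩
  · rintro _ ⟨S, hS, rfl⟩ _ ⟨T, hT, rfl⟩
    obtain ⟨U, hU, h1, h2⟩ := hc.directedOn S hS T hT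
    exact ⟨U, ⟨U, hU, rfl⟩, h1, h2⟩
  · rintro _ ⟨S, hS, rfl⟩
    exact S.2

theorem IsFac.subset (h : IsFac T) : ∃ M : ModuleCat.{0} Λ, M ∈ T ∧
    ∀ U, IsTorsionClass Λ U → M ∈ U → T ⊆ U := by
  obtain ⟨M, hM, hfac⟩ := h
  refine ⟨M, hM, fun U hU hMU X hX => ?_⟩
  obtain ⟨ι, _, g, hg⟩ := hfac X hX
  exact hU.quot g hg (hU.pi_finite hMU ι)

theorem IsFac.isFinGenTors (hT : IsTorsionClass Λ T) (h : IsFac T) : IsFinGenTors Λ T := by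
  obtain ⟨M, hM, h⟩ := h.subset
  refine ⟨hT, M, hT.1 _ hM, Set.Subset.antisymm (fun X hX U hU => ?_) ?_⟩
  · exact h U hU.1 (hU.2 rfl) hX
  · exact torsClosure_subset hT (Set.singleton_subset_iff.2 hM)

theorem isFac_fg : IsFac {M : ModuleCat.{0} Λ | FG Λ M} := by
  refine ⟨ModuleCat.of Λ Λ, inferInstanceAs (Module.Finite Λ Λ), fun X _ _ hX => ?_⟩
  have : Module.Finite Λ X := hX
  obtain ⟨n, f, hf⟩ := Module.Finite.exists_fin' Λ X
  exact ⟨Fin n, inferInstance, f, hf⟩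

/-- Ascending chains of torsion classes are stationary when all of them are finitely generated. -/
theorem wellFoundedGT_of_isFinGenTors (h : ∀ T, IsTorsionClass Λ T → IsFinGenTors Λ T) :
    WellFoundedGT (Tors Λ) := by
  rw [wellFoundedGT_iff_monotone_chain_condition]
  intro a
  obtain ⟨U, hU⟩ := exists_tors_iUnion (Set.range_nonempty a) a.monotone.isChain_range
  obtain ⟨-, M, -, hM⟩ := h U.1 U.2
  have hMU : M ∈ U.1 := by rw [hM]; exact subset_torsClosure _ rfl
  obtain ⟨_, ⟨n, rfl⟩, hn⟩ := (hU M).1 hMU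
  refine ⟨n, fun m hm => le_antisymm (a.monotone hm) fun X hX => ?_⟩
  have hXU : X ∈ U.1 := (hU X).2 ⟨_, ⟨m, rfl⟩, hX⟩
  rw [hM] at hXU
  exact torsClosure_subset (a n).2 (Set.singleton_subset_iff.2 hn) hXU

theorem IsFac.exists_le_covBy {T S : Tors Λ} (hF : IsFac T.1) (h : S < T) :
    ∃ T', S ≤ T' ∧ T' ⋖ T := by
  obtain ⟨M, hM, hsub⟩ := hF.subset
  obtain ⟨T', hST', hmax⟩ := zorn_le_nonempty₀ (Set.Iio T) (fun c hc hchain y hy => by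
    obtain ⟨U, hU⟩ := exists_tors_iUnion ⟨y, hy⟩ hchain
    refine ⟨U, Set.mem_Iio.2 (lt_of_le_not_ge (fun X hX => ?_) fun hle => ?_),
      fun z hz X hX => (hU X).2 ⟨z, hz, hX⟩⟩
    · obtain ⟨z, hz, hX⟩ := (hU X).1 hX
      exact (Set.mem_Iio.1 (hc hz)).le hX
    · obtain ⟨z, hz, hMz⟩ := (hU M).1 (hle hM)
      exact (Set.mem_Iio.1 (hc hz)).not_ge (hsub z.1 z.2 hMz)) S h
  exact ⟨T', hST', hmax.prop, fun U h1 h2 => (hmax.le_of_ge h2 h1.le).not_gt h1⟩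

theorem finite_tors_of_wellFoundedLT (K : Type) [Field K] [Algebra K Λ] [FiniteDimensional K Λ]
    [WellFoundedLT (Tors Λ)] : Finite (Tors Λ) := by
  have : IsArtinianRing Λ := IsArtinianRing.of_finite K Λ
  have key : ∀ T : Tors Λ, IsFac T.1 → (Set.Iic T).Finite := by
    intro T
    induction T using WellFoundedLT.induction with
    | ind T ih =>
      intro hF
      have hfin : (⋃ T' ∈ {T' | T' ⋖ T}, Set.Iic T').Finite :=
        (finite_covBy_of_wellFoundedLT T).biUnion fun T' hT' => ih T' hT'.lt (hF.of_covBy K hT')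
      refine (hfin.insert T).subset fun S hS => ?_
      rcases (show S ≤ T from hS).eq_or_lt with rfl | hlt
      · exact Set.mem_insert _ _
      · obtain ⟨T', h1, h2⟩ := hF.exists_le_covBy hlt
        exact Or.inr (Set.mem_biUnion h2 h1)
  have htop := key ⟨_, isTorsionClass_fg⟩ isFac_fg
  exact Set.finite_univ_iff.1 (htop.subset fun T _ X hX => T.2.1 X hX)

/-- If every proper torsion class has an upper cover then all torsion classes are `Fac`. -/
theorem isFac_of_exists_covBy (K : Type) [Field K] [Algebra K Λ] [FiniteDimensional K Λ]
    (h : ∀ T : Tors Λ, T.1 ≠ {M | FG Λ M} → ∃ T', T ⋖ T') (T : Tors Λ) : IsFac T.1 := by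
  by_contra hT
  obtain ⟨S, -, hmax⟩ := zorn_le_nonempty₀ {T : Tors Λ | ¬ IsFac T.1} (fun c hc hchain y hy => by
    obtain ⟨U, hU⟩ := exists_tors_iUnion ⟨y, hy⟩ hchain
    refine ⟨U, fun hF => ?_, fun z hz X hX => (hU X).2 ⟨z, hz, hX⟩⟩
    obtain ⟨M, hM, hsub⟩ := hF.subset
    obtain ⟨z, hz, hMz⟩ := (hU M).1 hM
    refine hc hz ?_
    rwa [show z = U from le_antisymm (fun X hX => (hU X).2 ⟨z, hz, hX⟩) (hsub z.1 z.2 hMz)]) T hT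
  obtain ⟨S', hS'⟩ := h S fun heq => hmax.prop (heq ▸ isFac_fg)
  refine hmax.prop (IsFac.of_covBy K hS' ?_)
  by_contra hn
  exact (hmax.le_of_ge hn hS'.le).not_gt hS'.lt

variable [IsArtinianRing Λ]

theorem IsBrick.surjective_of_mem {M : ModuleCat.{0} Λ} (hM : IsBrick Λ M)
    (hX : In (torsClosure Λ {M}) X) (g : X →ₗ[Λ] M) (hg : g ≠ 0) : Surjective g := by
  have hfg : ∀ N ∈ ({M} : Set (ModuleCat.{0} Λ)), FG Λ N := by
    rintro _ rfl; exact hM.1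
  have hI := (isTorsionClass_torsClosure hfg).range g hX
  have : Nontrivial (LinearMap.range g) := by
    rw [Submodule.nontrivial_iff_ne_bot]
    exact fun h => hg (LinearMap.range_eq_bot.1 h)
  obtain ⟨_, rfl, f, hf⟩ := exists_ne_zero_of_mem_torsClosure hfg hI
  have h1 := (hM.2.2 ((LinearMap.range g).subtype ∘ₗ f) fun h0 => hf (by
    ext x; exact LinearMap.congr_fun h0 x)).2
  intro y
  obtain ⟨x, rfl⟩ := h1 y
  exact (f x).2

theorem IsBrick.nonempty_equiv {M N : ModuleCat.{0} Λ} (hM : IsBrick Λ M) (hN : IsBrick Λ N)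
    (h : torsClosure Λ {M} = torsClosure Λ {N}) : Nonempty (M ≃ₗ[Λ] N) := by
  have key : ∀ {M N : ModuleCat.{0} Λ}, IsBrick Λ M → IsBrick Λ N →
      torsClosure Λ {M} = torsClosure Λ {N} → ∃ f : M →ₗ[Λ] N, Surjective f := by
    intro M N hM hN h
    have := hN.2.1
    have hNM : In (torsClosure Λ {M}) N := h ▸ subset_torsClosure _ rfl
    obtain ⟨_, rfl, f, hf⟩ := exists_ne_zero_of_mem_torsClosure (by
      rintro _ rfl; exact hM.1) hNM
    exact ⟨f, hN.surjective_of_mem (h ▸ subset_torsClosure _ rfl) f hf⟩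
  obtain ⟨f, hf⟩ := key hM hN h
  obtain ⟨g, hg⟩ := key hN hM h.symm
  have : Module.Finite Λ M := hM.1
  have hinj := IsNoetherian.injective_of_surjective_endomorphism (g ∘ₗ f) (hg.comp hf)
  exact ⟨LinearEquiv.ofBijective f ⟨Injective.of_comp hinj, hf⟩⟩

theorem brickFinite_of_finite_tors [Finite (Tors Λ)] : BrickFinite Λ := by
  classical
  let t : {M // IsBrick Λ M} → Tors Λ := fun M => ⟨torsClosure Λ {M.1},
    isTorsionClass_torsClosure (by rintro _ rfl; exact M.2.1)⟩
  choose s hs using fun U : Set.range t => U.2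
  refine ⟨Set.range fun U => (s U).1, Set.finite_range _, fun M hM => ?_⟩
  refine ⟨_, ⟨⟨t ⟨M, hM⟩, ⟨_, rfl⟩⟩, rfl⟩, ?_⟩
  exact hM.nonempty_equiv (s _).2 (congrArg Subtype.val (hs ⟨t ⟨M, hM⟩, ⟨_, rfl⟩⟩)).symm

theorem finite_tors_of_brickFinite (h : BrickFinite Λ) : Finite (Tors Λ) := by
  obtain ⟨S, hS, hiso⟩ := h
  have := hS.to_subtype
  refine Finite.of_injective (fun T : Tors Λ => {M : S | M.1 ∈ T.1}) ?_
  have key : ∀ T U : Tors Λ, {M : S | M.1 ∈ T.1} = {M : S | M.1 ∈ U.1} → T ≤ U := by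
    intro T U h
    refine subset_of_bricks T.2 U.2 fun M hM hMT => ?_
    obtain ⟨N, hN, ⟨e⟩⟩ := hiso M hM
    have h1 : (⟨N, hN⟩ : S) ∈ {M : S | M.1 ∈ T.1} := T.2.2.1 ⟨e⟩ hMT
    rw [h] at h1
    exact U.2.2.1 ⟨e.symm⟩ h1
  exact fun T U h => le_antisymm (key T U h) (key U T h.symm)

theorem isFinGenTors_of_wellFoundedGT [WellFoundedGT (Tors Λ)] (hT : IsTorsionClass Λ T) :
    IsFinGenTors Λ T := by
  let t : {M : ModuleCat.{0} Λ // FG Λ M} → Tors Λ := fun M => ⟨torsClosure Λ {M.1},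
    isTorsionClass_torsClosure (by rintro _ rfl; exact M.2)⟩
  obtain ⟨M, hM, hmax⟩ := (InvImage.wf t (wellFounded_gt (α := Tors Λ))).has_min
    {M | M.1 ∈ T} ⟨⟨ModuleCat.of Λ PUnit, inferInstanceAs (Module.Finite Λ PUnit)⟩,
      hT.zero (M := PUnit)⟩
  refine ⟨hT, M.1, M.2, Set.Subset.antisymm (fun X hX => ?_)
    (torsClosure_subset hT (Set.singleton_subset_iff.2 hM))⟩
  have hP : In T (M.1 × X) := hT.prod hM hX
  let P : {M : ModuleCat.{0} Λ // FG Λ M} := ⟨ModuleCat.of Λ (M.1 × X), hT.finite hP⟩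
  have hPt : In (t P).1 (M.1 × X) := subset_torsClosure _ rfl
  have hXt : X ∈ (t P).1 := (t P).2.quot (LinearMap.snd Λ M.1 X) LinearMap.snd_surjective hPt
  have hle : t M ≤ t P := torsClosure_subset (t P).2 (Set.singleton_subset_iff.2
    ((t P).2.quot (LinearMap.fst Λ M.1 X) LinearMap.fst_surjective hPt))
  rcases hle.eq_or_lt with heq | hlt
  · rw [← heq] at hXt; exact hXt
  · exact absurd hlt (hmax P hP)

end Lattice

section Wide

variable {Λ : Type} [Ring Λ] {T : Set (ModuleCat.{0} Λ)}
variable {A B C M N X Y : Type} [AddCommGroup A] [Module Λ A] [AddCommGroup B] [Module Λ B]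
  [AddCommGroup C] [Module Λ C] [AddCommGroup M] [Module Λ M] [AddCommGroup N] [Module Λ N]
  [AddCommGroup X] [Module Λ X] [AddCommGroup Y] [Module Λ Y]

theorem IsLabel.covBy [IsArtinianRing Λ] {T : Tors Λ} (hB : IsLabel T.1 B) :
    (⟨noMaps T.1 B, isTorsionClass_noMaps T.2⟩ : Tors Λ) ⋖ T := by
  refine ⟨lt_of_le_not_ge noMaps_subset fun h => hB.not_mem_noMaps (h hB.mem), fun U h1 h2 => ?_⟩
  have hBU : In U.1 B := by
    obtain ⟨Y, hY, hYn⟩ := Set.not_subset.1 (not_le_of_gt h1)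
    have : ∃ g : Y →ₗ[Λ] B, g ≠ 0 := by
      by_contra! h
      exact hYn ⟨h2.le hY, h⟩
    obtain ⟨g, hg⟩ := this
    exact U.2.quot g (hB.surjective Y (h2.le hY) g hg) hY
  obtain ⟨Z, hZ, hZn, hZf, hZs⟩ := exists_minimal_module T.2 U.2 (not_le_of_gt h2)
  have hZU : ¬ In U.1 Z := fun h => not_subsingleton Z (hZf.subsingleton h)
  have : ∃ g : Z →ₗ[Λ] B, g ≠ 0 := by
    by_contra! h
    exact hZU (h1.le ⟨hZ, h⟩)
  obtain ⟨g, hg⟩ := this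
  have hker : LinearMap.ker g = ⊥ := by
    by_contra hne
    have h3 := hZs _ (hB.ker_mem Z hZ g) (LinearMap.ker g).subtype fun h0 => hne <| by
      rw [← Submodule.range_subtype (LinearMap.ker g), h0, LinearMap.range_zero]
    refine hg (LinearMap.ker_eq_top.1 ?_)
    rw [← Submodule.range_subtype (LinearMap.ker g)]
    exact LinearMap.range_eq_top.2 h3
  exact hZU (U.2.equiv (LinearEquiv.ofBijective g
    ⟨LinearMap.ker_eq_bot.1 hker, hB.surjective Z hZ g hg⟩).symm hBU)

theorem isWide_alphaOf (hT : IsTorsionClass Λ T) : IsWide Λ (alphaOf Λ T) := by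
  have hker : ∀ {M X Y : Type} [AddCommGroup M] [Module Λ M] [AddCommGroup X] [Module Λ X]
      [AddCommGroup Y] [Module Λ Y] (f : M →ₗ[Λ] X) (g : M →ₗ[Λ] Y),
      LinearMap.ker f = LinearMap.ker g → In T (LinearMap.ker f) → In T (LinearMap.ker g) :=
    fun f g h => hT.equiv (LinearEquiv.ofEq _ _ h)
  refine ⟨fun M h => hT.1 M h.1, ?_, ?_, ?_, ?_, ?_⟩
  · rintro M N ⟨e⟩ ⟨hM, h⟩
    refine ⟨hT.equiv e hM, fun Y g hY => ?_⟩
    refine hker (e.symm.toLinearMap ∘ₗ g) g ?_ (h Y _ hY)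
    ext; simp
  · intro M hM
    refine ⟨hT.zero, fun Y g hY => ?_⟩
    refine hT.equiv (Submodule.topEquiv.symm.trans (LinearEquiv.ofEq _ _ ?_)) hY
    ext x
    simp [Subsingleton.elim (g x) 0]
  · rintro M N f ⟨hM, hM'⟩ ⟨hN, hN'⟩
    refine ⟨hN' M f hM, fun Y g hY => ?_⟩
    refine hker ((LinearMap.ker f).subtype ∘ₗ g) g ?_ (hM' Y _ hY)
    ext; simp
  · rintro M N f ⟨hM, hM'⟩ ⟨hN, hN'⟩
    refine ⟨hT.quot (Submodule.mkQ _) (Submodule.mkQ_surjective _) hN, fun Y g hY => ?_⟩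
    let g' : Y →ₗ[Λ] N ⧸ LinearMap.range f := g
    let S : Submodule Λ (N × Y) := LinearMap.eqLocus
      ((LinearMap.range f).mkQ ∘ₗ LinearMap.fst Λ N Y) (g' ∘ₗ LinearMap.snd Λ N Y)
    have hS : In T S := by
      refine hT.ext ((LinearMap.inl Λ N Y ∘ₗ (LinearMap.range f).subtype).codRestrict S
        fun x => ?_) (LinearMap.snd Λ N Y ∘ₗ S.subtype) ?_ ?_ ?_ (hT.range f hM) hY
      · have := (Submodule.Quotient.mk_eq_zero (LinearMap.range f)).2 x.2
        simp [S, LinearMap.mem_eqLocus, this]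
      · intro x y hxy
        exact Subtype.ext (congrArg (fun z : S => z.1.1) hxy)
      · intro y
        obtain ⟨n, hn⟩ := (LinearMap.range f).mkQ_surjective (g' y)
        exact ⟨⟨(n, y), hn⟩, rfl⟩
      · ext ⟨⟨n, y⟩, hy⟩
        have hy : (LinearMap.range f).mkQ n = g' y := hy
        simp only [LinearMap.mem_range, LinearMap.mem_ker]
        constructor
        · rintro ⟨x, hx⟩
          exact (congrArg (fun z : S => z.1.2) hx).symm
        · intro h0
          have h0 : y = 0 := h0
          subst h0
          rw [map_zero] at hy
          exact ⟨⟨n, (Submodule.Quotient.mk_eq_zero _).1 hy⟩, rfl⟩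
    have h1 := hN' (ModuleCat.of Λ S) (LinearMap.fst Λ N Y ∘ₗ S.subtype) hS
    refine hT.quot ((LinearMap.snd Λ N Y ∘ₗ S.subtype ∘ₗ
      (LinearMap.ker (LinearMap.fst Λ N Y ∘ₗ S.subtype)).subtype).codRestrict (LinearMap.ker g')
        fun x => ?_) ?_ h1
    · have h2 : x.1.1.1 = 0 := x.2
      have h3 : (LinearMap.range f).mkQ x.1.1.1 = g' x.1.1.2 := x.1.2
      rw [h2, map_zero] at h3
      exact h3.symm
    · rintro ⟨y, hy⟩
      have hy : g' y = 0 := hy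
      exact ⟨⟨⟨(0, y), by simp [S, LinearMap.mem_eqLocus, hy]⟩, rfl⟩, rfl⟩
  · rintro A M B f π hf hπ hfπ ⟨hA, hA'⟩ ⟨hB, hB'⟩
    refine ⟨hT.ext f π hf hπ hfπ hA hB, fun Y g hY => ?_⟩
    have h1 := hB' Y (π ∘ₗ g) hY
    let e := LinearEquiv.ofInjective f hf
    have hmem : ∀ x : LinearMap.ker (π ∘ₗ g), g x ∈ LinearMap.range f := fun x => by
      rw [hfπ]; exact x.2
    let k : LinearMap.ker (π ∘ₗ g) →ₗ[Λ] A := e.symm.toLinearMap ∘ₗ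
      (g ∘ₗ (LinearMap.ker (π ∘ₗ g)).subtype).codRestrict _ hmem
    have h2 := hA' (ModuleCat.of Λ _) k h1
    have hk : ∀ x, f (k x) = g x := fun x =>
      congrArg Subtype.val (e.apply_symm_apply ⟨g x, hmem x⟩)
    refine hT.quot (((LinearMap.ker (π ∘ₗ g)).subtype ∘ₗ (LinearMap.ker k).subtype).codRestrict
      (LinearMap.ker g) fun x => ?_) ?_ h2
    · have := hk x
      rw [show k x = 0 from x.2, map_zero] at this
      exact this.symm
    · rintro ⟨y, hy⟩
      have hy : g y = 0 := hy
      refine ⟨⟨⟨y, by simp [hy]⟩, hf ?_⟩, rfl⟩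
      exact (hk _).trans (hy.trans (map_zero f).symm)

theorem isWidelyGenTors_of_finite [IsArtinianRing Λ] [Finite (Tors Λ)] (hT : IsTorsionClass Λ T) :
    IsWidelyGenTors Λ T := by
  refine ⟨hT, alphaOf Λ T, isWide_alphaOf hT, ?_⟩
  have hsub : torsClosure Λ (alphaOf Λ T) ⊆ T := torsClosure_subset hT fun _ h => h.1
  by_contra hne
  obtain ⟨T', h1, h2⟩ := exists_le_covBy_of_lt (α := Tors Λ) (b := ⟨T, hT⟩)
    (a := ⟨torsClosure Λ (alphaOf Λ T), isTorsionClass_torsClosure (isWide_alphaOf hT).1⟩)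
    (lt_of_le_of_ne hsub fun h => hne (congrArg Subtype.val h).symm)
  obtain ⟨B, hB, -, hTB⟩ := exists_label_of_covBy h2
  have hBα : B ∈ alphaOf Λ T := ⟨hB.mem, fun Y g hY => hB.ker_mem Y hY g⟩
  have := h1 (subset_torsClosure _ hBα)
  rw [hTB] at this
  exact hB.not_mem_noMaps this

namespace IsWide

variable {W : Set (ModuleCat.{0} Λ)}

theorem equiv (hW : IsWide Λ W) (e : M ≃ₗ[Λ] N) (h : In W M) : In W N :=
  hW.2.1 (M := ModuleCat.of Λ M) (N := ModuleCat.of Λ N) ⟨e⟩ h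

theorem ker (hW : IsWide Λ W) (f : M →ₗ[Λ] N) (hM : In W M) (hN : In W N) :
    In W (LinearMap.ker f) :=
  hW.2.2.2.1 (M := ModuleCat.of Λ M) (N := ModuleCat.of Λ N) f hM hN

theorem coker (hW : IsWide Λ W) (f : M →ₗ[Λ] N) (hM : In W M) (hN : In W N) :
    In W (N ⧸ LinearMap.range f) :=
  hW.2.2.2.2.1 (M := ModuleCat.of Λ M) (N := ModuleCat.of Λ N) f hM hN

theorem range (hW : IsWide Λ W) (f : M →ₗ[Λ] N) (hM : In W M) (hN : In W N) :
    In W (LinearMap.range f) :=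
  hW.equiv (LinearEquiv.ofEq _ _ (Submodule.ker_mkQ _))
    (hW.ker (LinearMap.range f).mkQ hN (hW.coker f hM hN))

theorem quotient (hW : IsWide Λ W) {S : Submodule Λ M} (hS : In W S) (hM : In W M) :
    In W (M ⧸ S) :=
  hW.equiv (Submodule.quotEquivOfEq _ _ (Submodule.range_subtype S)) (hW.coker S.subtype hS hM)

variable [IsArtinianRing Λ]

theorem range_mem (hW : IsWide Λ W) (hY : In (torsClosure Λ W) Y) (hX : In W X)
    (g : Y →ₗ[Λ] X) : In W (LinearMap.range g) := by
  have hT := isTorsionClass_torsClosure hW.1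
  have : Module.Finite Λ X := hW.1 _ hX
  obtain ⟨S, ⟨hS, hSg⟩, hmax⟩ := (wellFounded_gt (α := Submodule Λ X)).has_min
    {S | In W S ∧ S ≤ LinearMap.range g} ⟨⊥, hW.2.2.1 _ inferInstance, bot_le⟩
  by_cases heq : LinearMap.range g ≤ S
  · rwa [← le_antisymm hSg heq]
  exfalso
  have : Nontrivial (LinearMap.range (S.mkQ ∘ₗ g)) := by
    rw [Submodule.nontrivial_iff_ne_bot]
    refine fun h0 => heq ?_
    rintro _ ⟨y, rfl⟩
    exact (Submodule.Quotient.mk_eq_zero S).1 (LinearMap.congr_fun (LinearMap.range_eq_bot.1 h0) y)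
  obtain ⟨N, hN, f, hf⟩ := exists_ne_zero_of_mem_torsClosure hW.1 (hT.range (S.mkQ ∘ₗ g) hY)
  let f' : N →ₗ[Λ] X ⧸ S := (LinearMap.range (S.mkQ ∘ₗ g)).subtype ∘ₗ f
  have hr : In W (LinearMap.range f') := hW.range f' hN (hW.quotient hS hX)
  let J : Submodule Λ X := (LinearMap.range f').comap S.mkQ
  have hSJ : S ≤ J := fun x hx => by
    have : S.mkQ x = 0 := (Submodule.Quotient.mk_eq_zero S).2 hx
    change S.mkQ x ∈ LinearMap.range f'
    rw [this]; exact Submodule.zero_mem _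
  have hJ : In W J := by
    let p : J →ₗ[Λ] LinearMap.range f' := S.mkQ.restrict fun x hx => hx
    refine hW.2.2.2.2.2 (A := ModuleCat.of Λ S) (M := ModuleCat.of Λ J)
      (B := ModuleCat.of Λ (LinearMap.range f')) (Submodule.inclusion hSJ) p
      (Submodule.inclusion_injective hSJ) ?_ ?_ hS hr
    · rintro ⟨y, hy⟩
      obtain ⟨x, rfl⟩ := S.mkQ_surjective y
      exact ⟨⟨x, hy⟩, rfl⟩
    · rw [Submodule.range_inclusion]
      ext ⟨x, hx⟩
      simp [p, LinearMap.restrict_apply]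
  refine hmax J ⟨hJ, ?_⟩ (lt_of_le_not_ge hSJ fun hJS => hf ?_)
  · rintro x ⟨n, hn⟩
    obtain ⟨y, hy⟩ := (f n).2
    have : S.mkQ x = S.mkQ (g y) := hn.symm.trans hy.symm
    have h1 := hSg ((Submodule.Quotient.eq S).1 this)
    rw [← sub_add_cancel x (g y)]
    exact Submodule.add_mem _ h1 ⟨y, rfl⟩
  · ext n
    obtain ⟨x, hx⟩ := S.mkQ_surjective (f n : X ⧸ S)
    have hxS : x ∈ S := hJS ⟨n, hx.symm⟩
    rw [← hx]
    exact (Submodule.Quotient.mk_eq_zero S).2 hxS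

theorem ker_eq_bot (hW : IsWide Λ W) (hY : In (torsClosure Λ W) Y) (hX : In W X)
    (g : Y →ₗ[Λ] X) (hg : Surjective g) (hK : TF (torsClosure Λ W) (LinearMap.ker g)) :
    LinearMap.ker g = ⊥ := by
  have hT := isTorsionClass_torsClosure hW.1
  induction hl : Module.length Λ Y using WellFoundedLT.induction generalizing X Y with
  | ind l ih =>
  subst hl
  rcases subsingleton_or_nontrivial Y with hs | hn
  · exact Subsingleton.elim _ _
  have := hT.finite hY
  obtain ⟨N, hN, f, hf⟩ := exists_ne_zero_of_mem_torsClosure hW.1 hY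
  have hkf : ∀ n, g (f n) = 0 → f n = 0 := by
    have h1 := subset_torsClosure W (hW.ker (g ∘ₗ f) hN hX)
    have h2 := hK _ h1 ((f ∘ₗ (LinearMap.ker (g ∘ₗ f)).subtype).codRestrict _ fun x => x.2)
    exact fun n hn => congrArg Subtype.val (LinearMap.congr_fun h2 ⟨n, hn⟩)
  have hle : LinearMap.range f ≤ (LinearMap.range (g ∘ₗ f)).comap g := by
    rintro _ ⟨n, rfl⟩
    exact ⟨n, rfl⟩
  let g' := (LinearMap.range f).mapQ (LinearMap.range (g ∘ₗ f)) g hle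
  have hg'x : ∀ y, g' ((LinearMap.range f).mkQ y) = (LinearMap.range (g ∘ₗ f)).mkQ (g y) :=
    fun y => Submodule.mapQ_apply _ _ _ _
  have hg' : Surjective g' := by
    intro x
    obtain ⟨x, rfl⟩ := Submodule.mkQ_surjective _ x
    obtain ⟨y, rfl⟩ := hg x
    exact ⟨_, hg'x y⟩
  have hkx : ∀ k, g k = 0 → (LinearMap.range f).mkQ k = 0 → k = 0 := by
    intro k hk hk0
    obtain ⟨n, rfl⟩ := (Submodule.Quotient.mk_eq_zero (LinearMap.range f)).1 hk0
    exact hkf n hk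
  let c : LinearMap.ker g →ₗ[Λ] LinearMap.ker g' :=
    ((LinearMap.range f).mkQ ∘ₗ (LinearMap.ker g).subtype).codRestrict _ fun k => by
      have : g k = 0 := k.2
      rw [LinearMap.mem_ker, LinearMap.comp_apply, hg'x]
      simp [this]
  have hc : Bijective c := by
    constructor
    · refine (injective_iff_map_eq_zero c).2 fun k hk => Subtype.ext ?_
      exact hkx k k.2 (congrArg Subtype.val hk)
    · rintro ⟨y, hy⟩
      obtain ⟨y, rfl⟩ := Submodule.mkQ_surjective _ y
      rw [LinearMap.mem_ker, hg'x] at hy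
      obtain ⟨n, hn⟩ := (Submodule.Quotient.mk_eq_zero (LinearMap.range (g ∘ₗ f))).1 hy
      refine ⟨⟨y - f n, ?_⟩, Subtype.ext ?_⟩
      · rw [LinearMap.mem_ker, map_sub, ← hn]; exact sub_self _
      · exact (Submodule.Quotient.eq _).2 (by simp)
  have hbot := ih (Module.length Λ (Y ⧸ LinearMap.range f))
    (Submodule.length_quotient_lt _ fun h => hf (LinearMap.range_eq_bot.1 h))
    (hT.quot _ (Submodule.mkQ_surjective _) hY) (hW.coker (g ∘ₗ f) hN hX) g' hg'
    (hK.of_injective (LinearEquiv.ofBijective c hc).symm.toLinearMap (LinearEquiv.injective _)) rfl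
  refine (Submodule.eq_bot_iff _).2 fun k hk => hkx k hk ?_
  exact (Submodule.mem_bot Λ).1 (hbot.le (c ⟨k, hk⟩).2)

theorem ker_mem (hW : IsWide Λ W) (hY : In (torsClosure Λ W) Y) (hX : In W X) (g : Y →ₗ[Λ] X) :
    In (torsClosure Λ W) (LinearMap.ker g) := by
  have hT := isTorsionClass_torsClosure hW.1
  have h1 := hT.ker_mem hY g.rangeRestrict g.surjective_rangeRestrict
    fun Z _ _ hZ k hk hK => hW.ker_eq_bot hZ (hW.range_mem hY hX g) k hk hK
  rwa [LinearMap.ker_rangeRestrict] at h1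

end IsWide

/-- A nonzero widely generated torsion class covers another torsion class. -/
theorem IsWidelyGenTors.exists_covBy [IsArtinianRing Λ] {T : Tors Λ}
    (h : IsWidelyGenTors Λ T.1) (hX : In T.1 X) [Nontrivial X] : ∃ T', T' ⋖ T := by
  obtain ⟨-, W, hW, hTW⟩ := h
  have hne : {B | B ∈ W ∧ Nontrivial B}.Nonempty := by
    rw [hTW] at hX
    obtain ⟨N, hN, f, hf⟩ := exists_ne_zero_of_mem_torsClosure hW.1 hX
    refine ⟨N, hN, not_subsingleton_iff_nontrivial.1 fun hs => hf ?_⟩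
    ext x
    rw [Subsingleton.elim x 0, map_zero, map_zero]
  obtain ⟨B, ⟨hB, hBn⟩, hmin⟩ := (InvImage.wf (fun B : ModuleCat.{0} Λ => Module.length Λ B)
    (wellFounded_lt (α := ℕ∞))).has_min _ hne
  have : Module.Finite Λ B := hW.1 _ hB
  refine ⟨_, IsLabel.covBy (B := B) ⟨?_, hBn, fun Y _ _ hY g hg => ?_, fun Y _ _ hY g => ?_⟩⟩
  · rw [hTW]; exact subset_torsClosure W hB
  · by_contra hs
    rw [hTW] at hY
    refine hmin (ModuleCat.of Λ (LinearMap.range g)) ⟨hW.range_mem hY hB g, ?_⟩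
      (Submodule.length_lt fun h => hs (LinearMap.range_eq_top.1 h))
    exact (Submodule.nontrivial_iff_ne_bot).2 fun h => hg (LinearMap.range_eq_bot.1 h)
  · rw [hTW] at hY ⊢
    exact hW.ker_mem hY hB g

end Wide

section Duality

variable {K A B : Type} [Field K] [Ring A] [Ring B] [Algebra K A] [Algebra K B]

/-- An anti-isomorphism of algebras, read backwards. -/
def flipOp (φ : A ≃ₐ[K] Bᵐᵒᵖ) : B ≃ₐ[K] Aᵐᵒᵖ := (AlgEquiv.opComm φ).symm

theorem unop_apply_unop_flipOp (φ : A ≃ₐ[K] Bᵐᵒᵖ) (b : B) : (φ (flipOp φ b).unop).unop = b := by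
  simp [flipOp, AlgEquiv.opComm]

/-- A `B`-module, regarded as a vector space. -/
def Res (_K _B N : Type) : Type := N

instance Res.addCommGroup {N : Type} [h : AddCommGroup N] : AddCommGroup (Res K B N) := h

instance Res.moduleOrig {N : Type} [AddCommGroup N] [h : Module B N] : Module B (Res K B N) := h

instance Res.module {N : Type} [AddCommGroup N] [Module B N] : Module K (Res K B N) :=
  Module.compHom (Res K B N) (algebraMap K B)

instance Res.isScalarTower {N : Type} [AddCommGroup N] [Module B N] :
    IsScalarTower K B (Res K B N) :=
  ⟨fun a b x => by rw [Algebra.smul_def, mul_smul]; rfl⟩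

/-- The `K`-dual of a `B`-module, an `A`-module through the anti-isomorphism `φ`. -/
def KDual (_φ : A ≃ₐ[K] Bᵐᵒᵖ) (N : Type) [AddCommGroup N] [Module B N] : Type :=
  Module.Dual K (Res K B N)

namespace KDual

variable {L M N : Type} [AddCommGroup L] [Module B L] [AddCommGroup M] [Module B M]
  [AddCommGroup N] [Module B N]

/-- A `B`-linear map, viewed as a `K`-linear map. -/
def restrict (f : M →ₗ[B] N) : Res K B M →ₗ[K] Res K B N :=
  LinearMap.restrictScalars K (M := Res K B M) (M₂ := Res K B N) (S := B) f

theorem restrict_injective {f : M →ₗ[B] N} (hf : Injective f) :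
    Injective (restrict (K := K) f) := hf

instance [FiniteDimensional K B] [h : Module.Finite B N] :
    FiniteDimensional K (Res K B N) := by
  have : Module.Finite B (Res K B N) := h
  exact Module.Finite.trans B _

variable (φ : A ≃ₐ[K] Bᵐᵒᵖ)

noncomputable instance : AddCommGroup (KDual φ N) :=
  inferInstanceAs (AddCommGroup (Module.Dual K (Res K B N)))

instance : FunLike (KDual φ N) N K :=
  inferInstanceAs (FunLike (Module.Dual K (Res K B N)) (Res K B N) K)

instance : AddMonoidHomClass (KDual φ N) N K where
  map_add f := LinearMap.map_add (M := Res K B N) f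
  map_zero f := LinearMap.map_zero (M := Res K B N) f

noncomputable instance : Module A (KDual φ N) where
  smul a f := LinearMap.comp (M₁ := Res K B N) f
    (Algebra.lsmul K K (Res K B N) (φ a).unop)
  one_smul f := DFunLike.ext _ _ fun x => congrArg f (by
    simp only [map_one, MulOpposite.unop_one]; rfl)
  mul_smul a b f := DFunLike.ext _ _ fun x => congrArg f (by
    simp only [map_mul, MulOpposite.unop_mul]; rfl)
  smul_zero a := rfl
  smul_add a f g := rfl
  add_smul a b f := DFunLike.ext _ _ fun x => by
    refine Eq.trans (congrArg f ?_) (map_add f ((φ a).unop • x) ((φ b).unop • x))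
    simp only [map_add, MulOpposite.unop_add]; rfl
  zero_smul f := DFunLike.ext _ _ fun x => by
    refine Eq.trans (congrArg f ?_) (map_zero f)
    simp only [map_zero, MulOpposite.unop_zero]; rfl

variable {φ}

theorem smul_apply (a : A) (f : KDual φ N) (x : N) : (a • f) x = f ((φ a).unop • x) := rfl

theorem apply_algebraMap_smul (f : KDual φ N) (k : K) (x : N) :
    f (algebraMap K B k • x) = k * f x := LinearMap.map_smul (M := Res K B N) f k x

theorem algebraMap_smul_apply (f : KDual φ N) (k : K) (x : N) :
    (algebraMap K A k • f) x = k * f x := by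
  rw [smul_apply, AlgEquiv.commutes]; exact apply_algebraMap_smul f k x

instance [FiniteDimensional K B] [Module.Finite B N] : Module.Finite A (KDual φ N) := by
  let e : Module.Dual K (Res K B N) →ₗ[K] Res K A (KDual φ N) :=
    { toFun := fun f => f
      map_add' := fun _ _ => rfl
      map_smul' := fun k f => DFunLike.ext (F := KDual φ N) _ _ fun x =>
        (algebraMap_smul_apply (φ := φ) f k x).symm }
  have : Module.Finite K (Res K A (KDual φ N)) :=
    Module.Finite.of_surjective e fun f => ⟨f, rfl⟩
  exact Module.Finite.of_restrictScalars_finite K A (Res K A (KDual φ N))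

instance [Subsingleton N] : Subsingleton (KDual φ N) :=
  ⟨fun f g => DFunLike.ext f g fun x => by simp [Subsingleton.elim x 0]⟩

variable (φ)

/-- The transpose of a module homomorphism. -/
def map (f : M →ₗ[B] N) : KDual φ N →ₗ[A] KDual φ M where
  toFun g := LinearMap.comp (M₂ := Res K B N) g (restrict f)
  map_add' _ _ := rfl
  map_smul' _ g := DFunLike.ext (F := KDual φ M) _ _ fun x => congrArg g (f.map_smul _ x).symm

theorem map_apply (f : M →ₗ[B] N) (g : KDual φ N) (x : M) : map φ f g x = g (f x) := rfl

variable {φ}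

theorem map_injective {f : M →ₗ[B] N} (hf : Surjective f) : Injective (map φ f) :=
  fun g h hgh => DFunLike.ext g h fun y => by
    obtain ⟨x, rfl⟩ := hf y
    exact DFunLike.congr_fun hgh x

theorem map_surjective {f : M →ₗ[B] N} (hf : Injective f) : Surjective (map φ f) :=
  LinearMap.dualMap_surjective_of_injective (restrict_injective (K := K) hf)

theorem range_map {f : L →ₗ[B] M} {g : M →ₗ[B] N} (hfg : LinearMap.range f = LinearMap.ker g) :
    LinearMap.range (map φ g) = LinearMap.ker (map φ f) := by
  have h : LinearMap.ker (restrict (K := K) g) = LinearMap.range (restrict (K := K) f) :=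
    SetLike.ext fun x => (SetLike.ext_iff.1 hfg x).symm
  have := (LinearMap.range_dualMap_eq_dualAnnihilator_ker (restrict (K := K) g)).trans
    ((congrArg _ h).trans (LinearMap.ker_dualMap_eq_dualAnnihilator_range _).symm)
  exact SetLike.ext fun x => SetLike.ext_iff.1 this x

theorem eq_zero_of_forall {x : N} (h : ∀ f : KDual φ N, f x = 0) : x = 0 :=
  (Module.forall_dual_apply_eq_zero_iff K (V := Res K B N) x).1 h

theorem eq_zero_of_map {f : M →ₗ[B] N} (h : map φ f = 0) : f = 0 :=
  LinearMap.ext fun x => eq_zero_of_forall (φ := φ) fun g => by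
    rw [← map_apply, h]; rfl

/-- Isomorphic modules have isomorphic duals. -/
noncomputable def congr (e : M ≃ₗ[B] N) : KDual φ N ≃ₗ[A] KDual φ M :=
  LinearEquiv.ofBijective (map φ e.toLinearMap)
    ⟨map_injective e.surjective, map_surjective e.injective⟩

/-- The dual of the kernel is the cokernel of the transpose. -/
noncomputable def kerEquiv (f : M →ₗ[B] N) :
    (KDual φ M ⧸ LinearMap.range (map φ f)) ≃ₗ[A] KDual φ (LinearMap.ker f) :=
  (Submodule.quotEquivOfEq _ _ (range_map (Submodule.range_subtype _))).trans
    (LinearMap.quotKerEquivOfSurjective _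
      (map_surjective (φ := φ) (Submodule.injective_subtype (LinearMap.ker f))))

/-- The dual of the cokernel is the kernel of the transpose. -/
noncomputable def cokerEquiv (f : M →ₗ[B] N) :
    KDual φ (N ⧸ LinearMap.range f) ≃ₗ[A] LinearMap.ker (map φ f) :=
  (LinearEquiv.ofInjective _ (map_injective (φ := φ) (LinearMap.range f).mkQ_surjective)).trans
    (LinearEquiv.ofEq _ _ (range_map (Submodule.ker_mkQ _).symm))

variable (φ)

/-- Evaluation into the double dual. -/
def eval : N →ₗ[B] KDual (flipOp φ) (KDual φ N) where
  toFun x :=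
    { toFun := fun f => (show KDual φ N from f) x
      map_add' := fun _ _ => rfl
      map_smul' := fun k f => algebraMap_smul_apply (φ := φ) f k x }
  map_add' x y := DFunLike.ext (F := KDual (flipOp φ) (KDual φ N)) _ _ fun f => map_add f x y
  map_smul' b x := DFunLike.ext (F := KDual (flipOp φ) (KDual φ N)) _ _ fun f => by
    change f (b • x) = f ((φ (flipOp φ b).unop).unop • x)
    rw [unop_apply_unop_flipOp]

/-- Finitely generated modules are reflexive. -/
noncomputable def evalEquiv [FiniteDimensional K B] [Module.Finite B N] :
    N ≃ₗ[B] KDual (flipOp φ) (KDual φ N) := by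
  refine LinearEquiv.ofBijective (eval φ) ⟨?_, fun F => ?_⟩
  · refine (injective_iff_map_eq_zero _).2 fun x hx => eq_zero_of_forall (φ := φ) fun f => ?_
    exact DFunLike.congr_fun hx f
  · let F' : Module.Dual K (Module.Dual K (Res K B N)) :=
      { toFun := fun f => F (show KDual φ N from f)
        map_add' := fun f g => map_add F _ _
        map_smul' := fun k f => by
          rw [RingHom.id_apply, smul_eq_mul, ← apply_algebraMap_smul F]
          congr 1
          exact DFunLike.ext (F := KDual φ N) _ _ fun x =>
            (algebraMap_smul_apply (φ := φ) f k x).symm }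
    obtain ⟨x, hx⟩ := (Module.evalEquiv K (Res K B N)).surjective F'
    exact ⟨x, DFunLike.ext (F := KDual (flipOp φ) (KDual φ N)) _ _ fun f =>
      LinearMap.congr_fun hx f⟩

end KDual

end Duality

section DualClasses

variable {K A B : Type} [Field K] [Ring A] [Ring B] [Algebra K A] [Algebra K B]
variable (φ : A ≃ₐ[K] Bᵐᵒᵖ) {C C' : Set (ModuleCat.{0} A)}

/-- The finitely generated modules whose dual belongs to `C`. -/
def dualClass (C : Set (ModuleCat.{0} A)) : Set (ModuleCat.{0} B) :=
  {N | FG B N ∧ In C (KDual φ N)}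

theorem dualClass_mono (h : C ⊆ C') : dualClass φ C ⊆ dualClass φ C' :=
  fun _ hN => ⟨hN.1, h hN.2⟩

/-- Torsion classes over opposite algebras correspond, in reverse order. -/
def dualTors (T : Tors A) : Tors B := ⟨lPerp B (dualClass φ T.1), isTorsionClass_lPerp _⟩

theorem dualTors_antitone : Antitone (dualTors φ) := fun _ _ h _ hN =>
  ⟨hN.1, fun Y hY f => hN.2 Y (dualClass_mono φ h hY) f⟩

theorem lPerp_rPerp [IsNoetherianRing A] (hC : IsTorsionClass A C) :
    lPerp A (rPerp A C) = C := by
  refine Set.Subset.antisymm (fun M hM => ?_) fun M hM => ⟨hC.1 M hM, fun Y hY f => hY.2 M hM f⟩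
  have := hM.1
  obtain ⟨S, hS, h0⟩ := hC.exists_torsion_submodule M
  have h := hM.2 (ModuleCat.of A (M ⧸ S))
    ⟨inferInstanceAs (Module.Finite A (M ⧸ S)), fun X hX f => h0 X hX f⟩ S.mkQ
  have hS' : S = ⊤ := by rw [← S.ker_mkQ, h, LinearMap.ker_zero]
  exact hC.equiv ((LinearEquiv.ofEq _ _ hS').trans Submodule.topEquiv) hS

theorem dualClass_dualClass [FiniteDimensional K A] (hfg : ∀ M ∈ C, FG A M) (hC : IsoClosed A C) :
    dualClass (flipOp φ) (dualClass φ C) = C := by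
  ext M
  refine ⟨fun h => ?_, fun h => ?_⟩
  · have := h.1
    exact hC (M := ModuleCat.of A (KDual φ (KDual (flipOp φ) M)))
      ⟨(KDual.evalEquiv (flipOp φ)).symm⟩ h.2.2
  · have := hfg M h
    exact ⟨this, inferInstanceAs (Module.Finite B (KDual (flipOp φ) M)),
      hC (N := ModuleCat.of A (KDual φ (KDual (flipOp φ) M)))
        ⟨KDual.evalEquiv (flipOp φ)⟩ h⟩

theorem isoClosed_dualClass (hC : IsoClosed A C) : IsoClosed B (dualClass φ C) := by
  rintro M N ⟨e⟩ ⟨hM, h⟩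
  have := hM
  exact ⟨Module.Finite.equiv e, hC (M := ModuleCat.of A (KDual φ M))
    (N := ModuleCat.of A (KDual φ N)) ⟨KDual.congr e.symm⟩ h⟩

theorem hasZeroObj_dualClass (hC : HasZeroObj A C) : HasZeroObj B (dualClass φ C) :=
  fun M _ => ⟨inferInstanceAs (Module.Finite B M),
    hC (ModuleCat.of A (KDual φ M)) (inferInstanceAs (Subsingleton (KDual φ M)))⟩

variable [FiniteDimensional K B]

theorem extClosed_dualClass (hC : ExtClosed A C) : ExtClosed B (dualClass φ C) := by
  rintro X M Y f g hf hg hfg ⟨hX, hX'⟩ ⟨hY, hY'⟩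
  have := IsNoetherianRing.of_finite K B
  have h1 : IsNoetherian B X := inferInstance
  have h2 : IsNoetherian B Y := inferInstance
  have : IsNoetherian B M := isNoetherian_of_range_eq_ker f g hfg
  exact ⟨inferInstanceAs (Module.Finite B M), hC (A := ModuleCat.of A (KDual φ Y))
    (M := ModuleCat.of A (KDual φ M)) (B := ModuleCat.of A (KDual φ X))
    (KDual.map φ g) (KDual.map φ f) (KDual.map_injective hg) (KDual.map_surjective hf)
    (KDual.range_map hfg) hY' hX'⟩

theorem isTorsionClass_dualClass (hC : IsTorsionFreeClass A C) :
    IsTorsionClass B (dualClass φ C) := by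
  refine ⟨fun M h => h.1, isoClosed_dualClass φ hC.2.1, hasZeroObj_dualClass φ hC.2.2.1, ?_,
    extClosed_dualClass φ hC.2.2.2.2⟩
  rintro M N g hg ⟨hM, h⟩
  have := hM
  exact ⟨Module.Finite.of_surjective g hg, hC.2.2.2.1 (M := ModuleCat.of A (KDual φ N))
    (N := ModuleCat.of A (KDual φ M)) (KDual.map φ g) (KDual.map_injective hg) h⟩

theorem isTorsionFreeClass_dualClass (hC : IsTorsionClass A C) :
    IsTorsionFreeClass B (dualClass φ C) := by
  refine ⟨fun M h => h.1, isoClosed_dualClass φ hC.2.1, hasZeroObj_dualClass φ hC.2.2.1, ?_,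
    extClosed_dualClass φ hC.2.2.2.2⟩
  rintro M N f hf ⟨hN, h⟩
  have := hN
  have := IsNoetherianRing.of_finite K B
  exact ⟨Module.Finite.of_injective f hf, hC.2.2.2.1 (M := ModuleCat.of A (KDual φ N))
    (N := ModuleCat.of A (KDual φ M)) (KDual.map φ f) (KDual.map_surjective hf) h⟩

theorem isWide_dualClass (hC : IsWide A C) : IsWide B (dualClass φ C) := by
  have := IsNoetherianRing.of_finite K B
  refine ⟨fun M h => h.1, isoClosed_dualClass φ hC.2.1, hasZeroObj_dualClass φ hC.2.2.1, ?_, ?_,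
    extClosed_dualClass φ hC.2.2.2.2.2⟩
  · rintro M N f ⟨hM, hM'⟩ ⟨-, hN'⟩
    have := hM
    exact ⟨inferInstanceAs (Module.Finite B (LinearMap.ker f)),
      hC.equiv (KDual.kerEquiv f) (hC.coker (KDual.map φ f) hN' hM')⟩
  · rintro M N f ⟨-, hM'⟩ ⟨hN, hN'⟩
    have := hN
    exact ⟨inferInstanceAs (Module.Finite B (N ⧸ LinearMap.range f)),
      hC.equiv (KDual.cokerEquiv f).symm (hC.ker (KDual.map φ f) hN' hM')⟩

variable [FiniteDimensional K A]

theorem isWidelyGenTors_dualClass (h : IsWidelyGenTorf A C) :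
    IsWidelyGenTors B (dualClass φ C) := by
  obtain ⟨hC, W, hW, rfl⟩ := h
  refine ⟨isTorsionClass_dualClass φ hC, dualClass φ W, isWide_dualClass φ hW,
    Set.Subset.antisymm (fun N hN U hU => ?_)
      (torsClosure_subset (isTorsionClass_dualClass φ hC)
        (dualClass_mono φ fun M hM _ hU => hU.2 hM))⟩
  rw [← dualClass_dualClass (flipOp φ) hU.1.1 hU.1.2.1]
  refine ⟨hN.1, hN.2 _ ⟨isTorsionFreeClass_dualClass (flipOp φ) hU.1, ?_⟩⟩
  rw [← dualClass_dualClass φ hW.1 hW.2.1]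
  exact dualClass_mono _ hU.2

theorem isWidelyGenTorf_dualClass (h : IsWidelyGenTors A C) :
    IsWidelyGenTorf B (dualClass φ C) := by
  obtain ⟨hC, W, hW, rfl⟩ := h
  refine ⟨isTorsionFreeClass_dualClass φ hC, dualClass φ W, isWide_dualClass φ hW,
    Set.Subset.antisymm (fun N hN U hU => ?_)
      (fun N hN => hN _ ⟨isTorsionFreeClass_dualClass φ hC,
        dualClass_mono φ (subset_torsClosure W)⟩)⟩
  rw [← dualClass_dualClass (flipOp φ) hU.1.1 hU.1.2.1]
  refine ⟨hN.1, hN.2 _ ⟨isTorsionClass_dualClass (flipOp φ) hU.1, ?_⟩⟩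
  rw [← dualClass_dualClass φ hW.1 hW.2.1]
  exact dualClass_mono _ hU.2

theorem dualClass_rPerp (hC : IsTorsionClass A C) :
    dualClass φ (rPerp A C) = lPerp B (dualClass φ C) := by
  ext N
  refine ⟨fun hN => ⟨hN.1, fun Y hY f => KDual.eq_zero_of_map (φ := φ) (hN.2.2 _ hY.2 _)⟩,
    fun hN => ?_⟩
  have := hN.1
  refine ⟨hN.1, inferInstanceAs (Module.Finite A (KDual φ N)), fun X hX f => ?_⟩
  have := hC.1 X hX
  have h := hN.2 (ModuleCat.of B (KDual (flipOp φ) X))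
    ⟨inferInstanceAs (Module.Finite B (KDual (flipOp φ) X)),
      hC.equiv (KDual.evalEquiv (flipOp φ)) hX⟩
    (KDual.map (flipOp φ) f ∘ₗ KDual.eval φ)
  refine KDual.eq_zero_of_map (φ := flipOp φ) (LinearMap.ext fun g => ?_)
  obtain ⟨x, rfl⟩ := (KDual.evalEquiv φ).surjective g
  exact LinearMap.congr_fun h x

theorem dualTors_dualTors (T : Tors A) : dualTors (flipOp φ) (dualTors φ T) = T := by
  have := IsNoetherianRing.of_finite K A
  refine Subtype.ext ?_
  change lPerp A (dualClass (flipOp φ) (lPerp B (dualClass φ T.1))) = T.1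
  rw [← dualClass_rPerp φ T.2, dualClass_dualClass φ (fun M h => h.1), lPerp_rPerp T.2]
  rintro M N ⟨e⟩ ⟨hM, h⟩
  have := hM
  refine ⟨Module.Finite.equiv e, fun X hX f => ?_⟩
  have h0 := h X hX (e.symm.toLinearMap ∘ₗ f)
  ext x
  simpa using LinearMap.congr_fun h0 x

/-- Torsion classes over opposite algebras form anti-isomorphic posets. -/
def torsIso : Tors A ≃o (Tors B)ᵒᵈ where
  toFun T := .toDual (dualTors φ T)
  invFun T := dualTors (flipOp φ) (OrderDual.ofDual T)
  left_inv := dualTors_dualTors φ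
  right_inv := dualTors_dualTors (flipOp φ)
  map_rel_iff' {T U} := by
    change dualTors φ U ≤ dualTors φ T ↔ T ≤ U
    refine ⟨fun h => ?_, fun h => dualTors_antitone φ h⟩
    rw [← dualTors_dualTors φ T, ← dualTors_dualTors φ U]
    exact dualTors_antitone (flipOp φ) h

end DualClasses

section Main

variable {K A B : Type} [Field K] [Ring A] [Ring B] [Algebra K A] [Algebra K B]
  [FiniteDimensional K A] [FiniteDimensional K B]

theorem finite_tors_iff_of_op (φ : A ≃ₐ[K] Bᵐᵒᵖ) : Finite (Tors A) ↔ Finite (Tors B) :=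
  (torsIso φ).toEquiv.finite_iff

theorem finite_tors_iff_brickFinite (K A : Type) [Field K] [Ring A] [Algebra K A]
    [FiniteDimensional K A] : Finite (Tors A) ↔ BrickFinite A := by
  have := IsArtinianRing.of_finite K A
  exact ⟨fun _ => brickFinite_of_finite_tors, finite_tors_of_brickFinite⟩

theorem finite_tors_of_isFinGenTors (φ : A ≃ₐ[K] Bᵐᵒᵖ)
    (h : ∀ T, IsTorsionClass A T → IsFinGenTors A T) : Finite (Tors A) := by
  have := IsArtinianRing.of_finite K A
  have := IsArtinianRing.of_finite K B
  have := wellFoundedGT_of_isFinGenTors h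
  have : WellFoundedLT (Tors B) := ⟨(torsIso (flipOp φ)).toOrderEmbedding.wellFounded
    (wellFounded_lt (α := (Tors A)ᵒᵈ))⟩
  exact (finite_tors_iff_of_op φ).2 (finite_tors_of_wellFoundedLT K)

theorem finite_tors_of_isWidelyGenTors (φ : A ≃ₐ[K] Bᵐᵒᵖ)
    (h : ∀ T, IsTorsionClass A T → IsWidelyGenTors A T) : Finite (Tors A) := by
  have := IsArtinianRing.of_finite K A
  have := IsArtinianRing.of_finite K B
  refine (finite_tors_iff_of_op φ).2 (finite_tors_of_isFinGenTors (flipOp φ) fun T hT => ?_)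
  refine IsFac.isFinGenTors hT (isFac_of_exists_covBy K (fun U hU => ?_) ⟨T, hT⟩)
  let V : Tors A := dualTors (flipOp φ) U
  have hV : ∃ X ∈ V.1, Nontrivial X := by
    by_contra! hV
    refine hU (Set.Subset.antisymm (fun M hM => U.2.1 M hM) fun M hM => ?_)
    rw [← dualTors_dualTors (flipOp φ) U]
    refine ⟨hM, fun Y hY f => ?_⟩
    have : Subsingleton (KDual φ Y) := hV _ hY.2
    exact KDual.eq_zero_of_map (φ := φ) (Subsingleton.elim _ _)
  obtain ⟨X, hX, hX'⟩ := hV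
  obtain ⟨V', hV'⟩ := (h V.1 V.2).exists_covBy (X := X) hX
  have hUV : dualTors φ V = U := dualTors_dualTors (flipOp φ) U
  exact ⟨dualTors φ V', by
    rw [← hUV]; exact (((apply_covBy_apply_iff (torsIso φ))).2 hV').ofDual⟩

end Main

/-- `Λ` is brick-finite iff every torsion-free class is widely generated, iff
every torsion class is widely generated, iff every torsion class is finitely generated. -/
theorem brickFinite_iff_all_classes_widely_or_finitely_generated
    (K Λ : Type) [Field K] [Ring Λ] [Algebra K Λ] [FiniteDimensional K Λ] :
    (BrickFinite Λ ↔ (∀ F, IsTorsionFreeClass Λ F → IsWidelyGenTorf Λ F)) ∧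
    (BrickFinite Λ ↔ (∀ T, IsTorsionClass Λ T → IsWidelyGenTors Λ T)) ∧
    (BrickFinite Λ ↔ (∀ T, IsTorsionClass Λ T → IsFinGenTors Λ T)) := by
  have := IsArtinianRing.of_finite K Λ
  have := IsArtinianRing.of_finite K Λᵐᵒᵖ
  let ψ : Λᵐᵒᵖ ≃ₐ[K] Λᵐᵒᵖ := AlgEquiv.refl
  let φ : Λ ≃ₐ[K] Λᵐᵒᵖᵐᵒᵖ := flipOp ψ
  rw [← finite_tors_iff_brickFinite K Λ]
  refine ⟨⟨fun h F hF => ?_, fun h => ?_⟩, ⟨fun h T hT => isWidelyGenTors_of_finite hT,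
    finite_tors_of_isWidelyGenTors φ⟩, fun h T hT => ?_, finite_tors_of_isFinGenTors φ⟩
  · have := (finite_tors_iff_of_op φ).1 h
    rw [← dualClass_dualClass φ hF.1 hF.2.1]
    exact isWidelyGenTorf_dualClass (flipOp φ)
      (isWidelyGenTors_of_finite (isTorsionClass_dualClass φ hF))
  · refine (finite_tors_iff_of_op φ).2 (finite_tors_of_isWidelyGenTors ψ fun T hT => ?_)
    rw [← dualClass_dualClass ψ hT.1 hT.2.1]
    exact isWidelyGenTors_dualClass (flipOp ψ) (h _ (isTorsionFreeClass_dualClass ψ hT))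
  · exact isFinGenTors_of_wellFoundedGT hT

end BrickPaper
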